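/- Let X ⊂ ℝ^{n+1} be a convex surface, let ∅ ≠ F ⊆ X be closed, and set d_F(z) := inf_{y ∈ F} dist_X(z, y) for z ∈ X. Then for every standard chart (e,V) on X with associated convex function f, the function x ↦ d_F(x + f(x)e) is locally DC on the open set {x ∈ V : x + f(x)e ∉ F}. -/

import Mathlib

open scoped NNReal

open Set

/-- `f` is DC on the convex set `C`: a difference of two continuous convex functions on `C`. -/
def IsDCOn {E : Type*} [NormedAddCommGroup E] [NormedSpace ℝ E]
    (C : Set E) (f : E → ℝ) : Prop :=
  ∃ g h : E → ℝ, ConvexOn ℝ C g ∧ ConvexOn ℝ C h ∧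
    ContinuousOn g C ∧ ContinuousOn h C ∧ ∀ x ∈ C, f x = g x - h x

/-- A mapping `F : C → F'` is DC if `ℓ ∘ F` is DC for every linear functional `ℓ`. -/
def IsDCMapOn {E F' : Type*} [NormedAddCommGroup E] [NormedSpace ℝ E]
    [NormedAddCommGroup F'] [NormedSpace ℝ F'] (C : Set E) (F : E → F') : Prop :=
  ∀ ℓ : F' →ₗ[ℝ] ℝ, IsDCOn C (fun x => ℓ (F x))

/-- `F` is locally DC on the open set `U`: every point of `U` has an open convex
neighborhood contained in `U` on which `F` is DC. -/
def LocallyDCMapOn {E F' : Type*} [NormedAddCommGroup E] [NormedSpace ℝ E]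
    [NormedAddCommGroup F'] [NormedSpace ℝ F'] (U : Set E) (F : E → F') : Prop :=
  ∀ x ∈ U, ∃ V : Set E, IsOpen V ∧ Convex ℝ V ∧ x ∈ V ∧ V ⊆ U ∧ IsDCMapOn V F

/-- `f` is locally DC on the open set `U`: every point of `U` has an open convex
neighborhood contained in `U` on which `f` is DC. -/
def LocallyDCOn {E : Type*} [NormedAddCommGroup E] [NormedSpace ℝ E]
    (U : Set E) (f : E → ℝ) : Prop :=
  ∀ x ∈ U, ∃ V : Set E, IsOpen V ∧ Convex ℝ V ∧ x ∈ V ∧ V ⊆ U ∧ IsDCOn V f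

/-- A convex body: a compact convex set with nonempty interior. -/
def IsConvexBody {E : Type*} [NormedAddCommGroup E] [NormedSpace ℝ E] (C : Set E) : Prop :=
  IsCompact C ∧ Convex ℝ C ∧ (interior C).Nonempty

/-- A convex surface: the boundary of a convex body. -/
def IsConvexSurface {E : Type*} [NormedAddCommGroup E] [NormedSpace ℝ E] (X : Set E) : Prop :=
  ∃ C : Set E, IsConvexBody C ∧ X = frontier C

/-- The intrinsic distance on `X ⊆ E`: the infimum of lengths (total variations) of
continuous curves `γ : [0,1] → E` joining `a` and `b` within `X`. -/
noncomputable def intrinsicDist {E : Type*} [NormedAddCommGroup E] [NormedSpace ℝ E]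
    (X : Set E) (a b : E) : ℝ :=
  (⨅ γ : {γ : ℝ → E // ContinuousOn γ (Set.Icc 0 1) ∧ γ 0 = a ∧ γ 1 = b ∧
      Set.MapsTo γ (Set.Icc 0 1) X},
    eVariationOn γ.1 (Set.Icc 0 1)).toReal

/-- An `(e,V)`-standard chart on `X`, given by a unit vector `e`, a convex open subset `V`
of the hyperplane `e^⊥`, and a Lipschitz convex function `f : V → ℝ` whose graph
`{x + f(x)e : x ∈ V}` is a relatively open subset of `X`. -/
def IsStandardChart {E : Type*} [NormedAddCommGroup E] [InnerProductSpace ℝ E]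
    (X : Set E) (e : E) (V : Set ↥((Submodule.span ℝ {e})ᗮ))
    (f : ↥((Submodule.span ℝ {e})ᗮ) → ℝ) : Prop :=
  ‖e‖ = 1 ∧ IsOpen V ∧ Convex ℝ V ∧ ConvexOn ℝ V f ∧
    (∃ K : ℝ≥0, LipschitzOnWith K f V) ∧
    ∃ O : Set E, IsOpen O ∧
      (fun x : ↥((Submodule.span ℝ {e})ᗮ) => (x : E) + f x • e) '' V = X ∩ O

open scoped ENNReal Topology
open Filter

section PathLength

variable {E : Type*} [NormedAddCommGroup E]

/-- The infimum of the lengths of continuous curves in `S` from `a` to `b`, as an extended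
nonnegative real. -/
noncomputable def pathELength (S : Set E) (a b : E) : ℝ≥0∞ :=
  ⨅ γ : {γ : ℝ → E // ContinuousOn γ (Set.Icc 0 1) ∧ γ 0 = a ∧ γ 1 = b ∧
      Set.MapsTo γ (Set.Icc 0 1) S},
    eVariationOn γ.1 (Set.Icc 0 1)

theorem pathELength_le {S : Set E} {a b : E} {γ : ℝ → E} (hc : ContinuousOn γ (Icc 0 1))
    (h0 : γ 0 = a) (h1 : γ 1 = b) (hm : MapsTo γ (Icc 0 1) S) :
    pathELength S a b ≤ eVariationOn γ (Icc 0 1) :=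
  iInf_le_of_le ⟨γ, hc, h0, h1, hm⟩ le_rfl

theorem exists_curve_of_pathELength_lt {S : Set E} {a b : E} {c : ℝ≥0∞}
    (h : pathELength S a b < c) :
    ∃ γ : ℝ → E, ContinuousOn γ (Icc 0 1) ∧ γ 0 = a ∧ γ 1 = b ∧ MapsTo γ (Icc 0 1) S ∧
      eVariationOn γ (Icc 0 1) < c := by
  obtain ⟨⟨γ, h1, h2, h3, h4⟩, h5⟩ := iInf_lt_iff.1 h
  exact ⟨γ, h1, h2, h3, h4, h5⟩

theorem edist_le_pathELength (S : Set E) (a b : E) : edist a b ≤ pathELength S a b := by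
  refine le_iInf ?_
  rintro ⟨γ, -, rfl, rfl, -⟩
  exact eVariationOn.edist_le γ (by simp) (by simp)

theorem pathELength_mono {S T : Set E} (h : S ⊆ T) (a b : E) :
    pathELength T a b ≤ pathELength S a b := by
  refine le_iInf ?_
  rintro ⟨γ, h1, h2, h3, h4⟩
  exact pathELength_le h1 h2 h3 (h4.mono_right h)

theorem pathELength_image_le {S T : Set E} {c : ℝ≥0} (hc : c ≠ 0) {π : E → E}
    (hπ : LipschitzOnWith c π S) (hm : MapsTo π S T) (a b : E) :
    pathELength T (π a) (π b) ≤ c * pathELength S a b := by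
  rw [pathELength, pathELength, ENNReal.mul_iInf_of_ne (by simpa using hc) ENNReal.coe_ne_top]
  refine le_iInf ?_
  rintro ⟨γ, h1, rfl, rfl, h4⟩
  exact (pathELength_le (hπ.continuousOn.comp h1 h4) rfl rfl (hm.comp h4)).trans
    (hπ.comp_eVariationOn_le h4)

theorem pathELength_triangle (S : Set E) (a b c : E) :
    pathELength S a c ≤ pathELength S a b + pathELength S b c := by
  refine ENNReal.le_iInf_add_iInf ?_
  rintro ⟨γ₁, c1, rfl, rfl, m1⟩ ⟨γ₂, c2, h2, rfl, m2⟩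
  set γ : ℝ → E := fun t => if t ≤ 1 / 2 then γ₁ (2 * t) else γ₂ (2 * t - 1) with hγ
  have e1 : EqOn γ (γ₁ ∘ fun t => 2 * t) (Icc 0 (1 / 2)) := fun t ht => by
    simp only [hγ, Function.comp, if_pos ht.2]
  have e2 : EqOn γ (γ₂ ∘ fun t => 2 * t - 1) (Icc (1 / 2) 1) := fun t ht => by
    rcases ht.1.eq_or_lt with h | h
    · subst h
      simp [hγ, h2]
    · simp only [hγ, Function.comp, if_neg (not_le.2 h)]
  have t1 : MapsTo (fun t : ℝ => 2 * t) (Icc 0 (1 / 2)) (Icc 0 1) := fun t ht => by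
    constructor <;> linarith [ht.1, ht.2]
  have t2 : MapsTo (fun t : ℝ => 2 * t - 1) (Icc (1 / 2) 1) (Icc 0 1) := fun t ht => by
    constructor <;> linarith [ht.1, ht.2]
  have hun : Icc (0 : ℝ) (1 / 2) ∪ Icc (1 / 2) 1 = Icc 0 1 :=
    Icc_union_Icc_eq_Icc (by norm_num) (by norm_num)
  have hcont : ContinuousOn γ (Icc 0 1) := by
    rw [← hun]
    refine ContinuousOn.union_of_isClosed ?_ ?_ isClosed_Icc isClosed_Icc
    · exact (c1.comp (by fun_prop) t1).congr e1
    · exact (c2.comp (by fun_prop) t2).congr e2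
  have hmaps : MapsTo γ (Icc 0 1) S := by
    rw [← hun, mapsTo_union]
    exact ⟨(m1.comp t1).congr e1.symm, (m2.comp t2).congr e2.symm⟩
  refine (pathELength_le hcont (by simp [hγ]) (by simp [hγ]; norm_num) hmaps).trans ?_
  have hsplit := eVariationOn.Icc_add_Icc γ (s := univ) (a := 0) (b := 1 / 2) (c := 1)
    (by norm_num) (by norm_num) (mem_univ _)
  simp only [univ_inter] at hsplit
  rw [← hsplit, eVariationOn.congr e1, eVariationOn.congr e2]
  gcongr
  · exact eVariationOn.comp_le_of_monotoneOn _ _ (fun x _ y _ h => by simpa using h) t1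
  · exact eVariationOn.comp_le_of_monotoneOn _ _ (fun x _ y _ h => by simpa using h) t2

variable [NormedSpace ℝ E]

theorem intrinsicDist_eq_toReal (X : Set E) (a b : E) :
    intrinsicDist X a b = (pathELength X a b).toReal := rfl

theorem pathELength_le_of_segment_subset {S : Set E} {a b : E} (h : segment ℝ a b ⊆ S) :
    pathELength S a b ≤ ENNReal.ofReal ‖b - a‖ := by
  have hl : LipschitzOnWith ‖b - a‖₊ (AffineMap.lineMap a b : ℝ → E) univ := by
    refine LipschitzOnWith.of_dist_le_mul fun x _ y _ => ?_
    rw [dist_lineMap_lineMap, dist_comm a b, dist_eq_norm b a, mul_comm]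
    rfl
  have hm : MapsTo (AffineMap.lineMap a b : ℝ → E) (Icc 0 1) S := fun t ht =>
    h (by rw [segment_eq_image_lineMap]; exact ⟨t, ht, rfl⟩)
  refine (pathELength_le (by fun_prop) (by simp) (by simp) hm).trans ?_
  have h1 := hl.comp_eVariationOn_le (g := (id : ℝ → ℝ)) (s := Icc 0 1) (mapsTo_univ _ _)
  have h2 : eVariationOn (id : ℝ → ℝ) (Icc 0 1) ≤ 1 := by
    have := (monotoneOn_id (s := Icc (0 : ℝ) 1)).eVariationOn_eq (a := 0) (b := 1)
      (by simp) (by simp)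
    simp_all
  refine (h1.trans (mul_le_mul_right h2 _)).trans ?_
  rw [mul_one, ENNReal.ofReal, norm_toNNReal]

theorem pathELength_self {S : Set E} {a : E} (h : a ∈ S) : pathELength S a a = 0 := by
  simpa using pathELength_le_of_segment_subset (S := S) (a := a) (b := a) (by simpa using h)

end PathLength

section Projection

variable {E : Type*} [NormedAddCommGroup E] [InnerProductSpace ℝ E] [CompleteSpace E]

theorem exists_nonexpansive_retraction {K U : Set E} (hne : K.Nonempty) (hcl : IsClosed K)
    (hcv : Convex ℝ K) (hU : IsOpen U) (hUK : U ⊆ K) :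
    ∃ π : E → E, LipschitzWith 1 π ∧ (∀ x ∈ K, π x = x) ∧ MapsTo π Uᶜ (K \ U) := by
  choose π hπK hπ using exists_norm_eq_iInf_of_complete_convex hne hcl.isComplete hcv
  have hin : ∀ u, ∀ w ∈ K, inner ℝ (u - π u) (w - π u) ≤ 0 := fun u =>
    (norm_eq_iInf_iff_real_inner_le_zero hcv (hπK u)).1 (hπ u)
  refine ⟨π, LipschitzWith.of_dist_le_mul fun x y => ?_, fun x hx => ?_, fun x hx => ⟨hπK x, ?_⟩⟩
  · rw [NNReal.coe_one, one_mul, dist_eq_norm, dist_eq_norm]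
    have h1 := hin x _ (hπK y)
    have h2 := hin y _ (hπK x)
    have h3 : ‖π x - π y‖ ^ 2 ≤ inner ℝ (x - y) (π x - π y) := by
      rw [← real_inner_self_eq_norm_sq]
      simp only [inner_sub_left, inner_sub_right] at h1 h2 ⊢
      linarith
    have h4 := real_inner_le_norm (x - y) (π x - π y)
    by_contra! hlt
    nlinarith [norm_nonneg (x - y), norm_nonneg (π x - π y)]
  · have := hin x x hx
    rw [real_inner_self_eq_norm_sq] at this
    have h0 : ‖x - π x‖ = 0 := by nlinarith [norm_nonneg (x - π x)]
    exact (sub_eq_zero.1 (norm_eq_zero.1 h0)).symm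
  · intro hmem
    have hev : ∀ᶠ δ in 𝓝[>] (0 : ℝ), π x + δ • (x - π x) ∈ U := by
      have ht : Tendsto (fun δ : ℝ => π x + δ • (x - π x)) (𝓝[>] 0) (𝓝 (π x)) := by
        have : Continuous fun δ : ℝ => π x + δ • (x - π x) := by fun_prop
        simpa using (this.tendsto 0).mono_left nhdsWithin_le_nhds
      exact ht.eventually (hU.mem_nhds hmem)
    obtain ⟨δ, hδ, hδ0⟩ := (hev.and self_mem_nhdsWithin).exists
    have h := hin x _ (hUK hδ)
    rw [add_sub_cancel_left, inner_smul_right, real_inner_self_eq_norm_sq] at h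
    have hδ0 : 0 < δ := hδ0
    have h0 : ‖x - π x‖ = 0 := by
      by_contra hne
      have : 0 < ‖x - π x‖ ^ 2 := by positivity
      nlinarith
    have : x = π x := sub_eq_zero.1 (norm_eq_zero.1 h0)
    exact hx (this ▸ hmem)

theorem pathELength_diff_le {K U : Set E} (hcl : IsClosed K) (hcv : Convex ℝ K) (hU : IsOpen U)
    (hUK : U ⊆ K) {a b : E} (ha : a ∈ K) (hb : b ∈ K) :
    pathELength (K \ U) a b ≤ pathELength Uᶜ a b := by
  obtain ⟨π, h1, h2, h3⟩ := exists_nonexpansive_retraction ⟨a, ha⟩ hcl hcv hU hUK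
  simpa [h2 a ha, h2 b hb] using
    pathELength_image_le one_ne_zero (h1.lipschitzOnWith (s := Uᶜ)) h3 a b

end Projection

section Chains

variable {E : Type*} [NormedAddCommGroup E] [InnerProductSpace ℝ E] {ι : Type*}

/-- The union of the closed half-spaces `{x | b i ≤ g i x}`. -/
def halfspaceUnion (g : ι → StrongDual ℝ E) (b : ι → ℝ) : Set E := {x | ∃ i, b i ≤ g i x}

/-- `HyperplaneChain g b y a ℓ` says that `a` can be joined to `y` by a polygonal path of length at
most `ℓ`, each link of which lies in one of the hyperplanes `{x | g i x = b i}`. -/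
inductive HyperplaneChain (g : ι → StrongDual ℝ E) (b : ι → ℝ) (y : E) : E → ℝ → Prop
  | nil {ℓ : ℝ} (h : 0 ≤ ℓ) : HyperplaneChain g b y y ℓ
  | cons {a p : E} {ℓ : ℝ} (i : ι) (ha : g i a = b i) (hp : g i p = b i)
      (h : HyperplaneChain g b y p ℓ) : HyperplaneChain g b y a (dist a p + ℓ)

variable {g : ι → StrongDual ℝ E} {b : ι → ℝ} {y : E}

theorem HyperplaneChain.nonneg {a : E} {ℓ : ℝ} (h : HyperplaneChain g b y a ℓ) : 0 ≤ ℓ := by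
  induction h with
  | nil h => exact h
  | cons _ _ _ _ ih => exact add_nonneg dist_nonneg ih

theorem HyperplaneChain.dist_le {a : E} {ℓ : ℝ} (h : HyperplaneChain g b y a ℓ) :
    dist a y ≤ ℓ := by
  induction h with
  | nil h => simpa using h
  | @cons a p ℓ _ _ _ _ ih => exact (dist_triangle a p y).trans (by gcongr)

theorem pathELength_halfspaceUnion_le {a c : E} (i : ι) (ha : b i ≤ g i a) (hc : b i ≤ g i c) :
    pathELength (halfspaceUnion g b) a c ≤ ENNReal.ofReal ‖c - a‖ := by
  refine pathELength_le_of_segment_subset fun x hx => ⟨i, ?_⟩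
  exact (convex_halfSpace_ge (g i).isLinear (b i)).segment_subset ha hc hx

theorem eq_zero_of_eventually_nonneg {c C : ℝ} (h : ∀ᶠ s in 𝓝 (0 : ℝ), 0 ≤ s * c + s ^ 2 * C) :
    c = 0 := by
  have hd : HasDerivAt (fun s : ℝ => s * c + s ^ 2 * C) c 0 := by
    have h1 := ((hasDerivAt_id' (0 : ℝ)).mul_const c).fun_add
      (((hasDerivAt_id' (0 : ℝ)).fun_pow 2).mul_const C)
    simpa using h1
  exact IsLocalMin.hasDerivAt_eq_zero (h.mono fun s hs => by simpa using hs) hd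

theorem norm_smul_add_smul_le {u z : E} (hu : ‖u‖ = 1) {l : ℝ} (hl : 0 < l) (s : ℝ) :
    ‖l • u + s • z‖ ≤ l + s * inner ℝ u z + s ^ 2 * (‖z‖ ^ 2 / (2 * l)) := by
  have h1 : ‖l • u + s • z‖ ^ 2 = l ^ 2 + 2 * (l * s * inner ℝ u z) + s ^ 2 * ‖z‖ ^ 2 := by
    rw [norm_add_sq_real, norm_smul, norm_smul, inner_smul_left, inner_smul_right, hu, mul_pow,
      mul_pow, Real.norm_eq_abs, Real.norm_eq_abs, sq_abs, sq_abs]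
    simp [mul_assoc]
  have h2 : 0 ≤ (‖l • u + s • z‖ - l) ^ 2 := sq_nonneg _
  have h3 : l + s * inner ℝ u z + s ^ 2 * (‖z‖ ^ 2 / (2 * l))
      = (2 * l ^ 2 + 2 * (l * s * inner ℝ u z) + s ^ 2 * ‖z‖ ^ 2) / (2 * l) := by
    field_simp
  rw [h3, le_div_iff₀ (by positivity)]
  nlinarith

theorem norm_smul_sub_smul_eq {u v z : E} (hu : ‖u‖ = 1) (hv : ‖v‖ = 1)
    (h : inner ℝ u z = inner ℝ v z) (l s : ℝ) : ‖l • u - s • z‖ = ‖l • v - s • z‖ := by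
  rw [← sq_eq_sq₀ (norm_nonneg _) (norm_nonneg _), norm_sub_sq_real, norm_sub_sq_real]
  simp [inner_smul_left, inner_smul_right, norm_smul, hu, hv, h]

/-- The length comparison for variations of a shortest chain of hyperplane links: in a direction
tangent to its first hyperplane, distances are at most those in the Euclidean development. -/
theorem HyperplaneChain.exists_variation {a : E} {ℓ : ℝ} (hch : HyperplaneChain g b y a ℓ)
    (hmin : ENNReal.ofReal ℓ ≤ pathELength (halfspaceUnion g b) a y) (hay : a ≠ y) :
    ∃ i u, ‖u‖ = 1 ∧ g i a = b i ∧ ∀ w, g i w = 0 → ∀ᶠ s in 𝓝 (0 : ℝ),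
      pathELength (halfspaceUnion g b) (a + s • w) y ≤ ENNReal.ofReal ‖ℓ • u - s • w‖ := by
  induction hch with
  | nil => exact absurd rfl hay
  | @cons a p ℓ' i ha hp hch ih =>
    have hℓ' := hch.nonneg
    have hap : pathELength (halfspaceUnion g b) a p ≤ ENNReal.ofReal (dist a p) := by
      rw [dist_comm, dist_eq_norm]
      exact pathELength_halfspaceUnion_le i ha.ge hp.ge
    have hminp : ENNReal.ofReal ℓ' ≤ pathELength (halfspaceUnion g b) p y := by
      have h := (hmin.trans (pathELength_triangle _ a p y)).trans (add_le_add_left hap _)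
      rw [ENNReal.ofReal_add dist_nonneg hℓ'] at h
      exact (ENNReal.add_le_add_iff_left ENNReal.ofReal_ne_top).1 h
    rcases eq_or_ne p y with rfl | hpy
    · have h0 : ℓ' = 0 := by
        rw [pathELength_self (show p ∈ halfspaceUnion g b from ⟨i, hp.ge⟩), nonpos_iff_eq_zero,
          ENNReal.ofReal_eq_zero] at hminp
        exact le_antisymm hminp hℓ'
      have hd : 0 < dist a p := dist_pos.2 hay
      refine ⟨i, (dist a p)⁻¹ • (p - a), ?_, ha, fun w hw => Eventually.of_forall fun s => ?_⟩
      · rw [norm_smul, norm_inv, Real.norm_eq_abs, abs_of_pos hd, ← dist_eq_norm, dist_comm p a,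
          inv_mul_cancel₀ hd.ne']
      · refine (pathELength_halfspaceUnion_le i (by simp [hw, ha]) hp.ge).trans_eq ?_
        rw [h0, add_zero, smul_smul, mul_inv_cancel₀ hd.ne', one_smul]
        congr 2
        abel
    rcases eq_or_ne a p with rfl | hap'
    · simpa using ih hminp hpy
    obtain ⟨i₂, u₂, hu₂, hp₂, hvar⟩ := ih hminp hpy
    have hℓ1 : 0 < dist a p := dist_pos.2 hap'
    have hℓ'pos : 0 < ℓ' := (dist_pos.2 hpy).trans_le hch.dist_le
    set ℓ₁ := dist a p with hℓ₁
    obtain ⟨u₁, hu₁, hpa⟩ : ∃ u₁ : E, ‖u₁‖ = 1 ∧ p = a + ℓ₁ • u₁ := by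
      refine ⟨ℓ₁⁻¹ • (p - a), ?_, ?_⟩
      · rw [norm_smul, norm_inv, Real.norm_eq_abs, abs_of_pos hℓ1, ← dist_eq_norm, dist_comm p a,
          inv_mul_cancel₀ hℓ1.ne']
      · rw [smul_smul, mul_inv_cancel₀ hℓ1.ne', one_smul, add_sub_cancel]
    have hu₁0 : ∀ j, g j a = b j → g j p = b j → g j u₁ = 0 := fun j h1 h2 => by
      rw [hpa, map_add, map_smul, h1, smul_eq_mul, add_eq_left] at h2
      exact (mul_eq_zero.1 h2).resolve_left hℓ1.ne'
    obtain ⟨j, hja, hjp, hjk⟩ : ∃ j, g j a = b j ∧ g j p = b j ∧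
        ∀ w, g j w = 0 → ∃ k : ℝ, g i₂ (w + k • u₁) = 0 := by
      by_cases h : g i₂ a = b i₂
      · exact ⟨i₂, h, hp₂, fun w hw => ⟨0, by simpa using hw⟩⟩
      · have hne : g i₂ u₁ ≠ 0 := fun h0 => h (by
          rw [hpa, map_add, map_smul, h0, smul_zero, add_zero] at hp₂
          exact hp₂)
        refine ⟨i, ha, hp, fun w _ => ⟨-(g i₂ w) / g i₂ u₁, ?_⟩⟩
        rw [map_add, map_smul, smul_eq_mul, div_mul_cancel₀ _ hne, add_neg_cancel]
    have hju := hu₁0 j hja hjp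
    refine ⟨j, u₁, hu₁, hja, fun w hw => ?_⟩
    obtain ⟨k, hk⟩ := hjk w hw
    set z := w + k • u₁ with hz
    have hjz : g j z = 0 := by simp [hz, hw, hju]
    have hvz := hvar z hk
    have hsnell : inner ℝ u₁ z = inner ℝ u₂ z := by
      refine sub_eq_zero.1 (eq_zero_of_eventually_nonneg (C := ‖z‖ ^ 2 / (2 * ℓ₁) +
        ‖z‖ ^ 2 / (2 * ℓ')) (hvz.mono fun s hs => ?_))
      have h1 : ENNReal.ofReal (ℓ₁ + ℓ') ≤
          ENNReal.ofReal (‖ℓ₁ • u₁ + s • z‖ + ‖ℓ' • u₂ - s • z‖) := by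
        refine (hmin.trans (pathELength_triangle _ a (p + s • z) y)).trans ?_
        rw [ENNReal.ofReal_add (norm_nonneg _) (norm_nonneg _)]
        refine add_le_add ?_ hs
        refine (pathELength_halfspaceUnion_le j hja.ge (by simp [hjz, hjp])).trans_eq ?_
        rw [hpa]
        congr 2
        abel
      rw [ENNReal.ofReal_le_ofReal_iff (by positivity)] at h1
      have h2 := norm_smul_add_smul_le (z := z) hu₁ hℓ1 s
      have h3 := norm_smul_add_smul_le (z := z) hu₂ hℓ'pos (-s)
      rw [neg_smul, ← sub_eq_add_neg] at h3
      nlinarith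
    have hden : ∀ᶠ s in 𝓝 (0 : ℝ), ℓ' < ℓ₁ + ℓ' + s * k := by
      have : Tendsto (fun s : ℝ => ℓ₁ + ℓ' + s * k) (𝓝 0) (𝓝 (ℓ₁ + ℓ' + 0 * k)) :=
        Continuous.tendsto (by fun_prop) 0
      exact this.eventually (lt_mem_nhds (by linarith))
    have hσ : Tendsto (fun s : ℝ => s * (ℓ' / (ℓ₁ + ℓ' + s * k))) (𝓝 0) (𝓝 0) := by
      have : ContinuousAt (fun s : ℝ => s * (ℓ' / (ℓ₁ + ℓ' + s * k))) 0 := by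
        refine continuousAt_id.mul (ContinuousAt.div (by fun_prop) (by fun_prop) ?_)
        simp
        positivity
      simpa [ContinuousAt] using this
    filter_upwards [hden, hσ.eventually hvz] with s hs hs'
    have hpos : 0 < ℓ₁ + ℓ' + s * k := by linarith
    set μ := ℓ' / (ℓ₁ + ℓ' + s * k) with hμ
    have hμe : μ * (ℓ₁ + ℓ' + s * k) = ℓ' := div_mul_cancel₀ _ hpos.ne'
    have hμ0 : 0 ≤ μ := by positivity
    have hμ1 : μ ≤ 1 := (div_le_one hpos).2 hs.le
    refine (pathELength_triangle _ _ (p + (s * μ) • z) y).trans ?_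
    have e1 : p + (s * μ) • z - (a + s • w) = (1 - μ) • ((ℓ₁ + ℓ') • u₁ - s • w) := by
      have hc : ℓ₁ + s * μ * k = (1 - μ) * (ℓ₁ + ℓ') := by linarith
      have : p + (s * μ) • z - (a + s • w) = (ℓ₁ + s * μ * k) • u₁ - ((1 - μ) * s) • w := by
        rw [hpa, hz]
        module
      rw [this, hc]
      module
    have e2 : ℓ' • u₁ - (s * μ) • z = μ • ((ℓ₁ + ℓ') • u₁ - s • w) := by
      have hc : ℓ' - s * μ * k = μ * (ℓ₁ + ℓ') := by linarith
      have : ℓ' • u₁ - (s * μ) • z = (ℓ' - s * μ * k) • u₁ - (μ * s) • w := by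
        rw [hz]
        module
      rw [this, hc]
      module
    calc _ ≤ ENNReal.ofReal ‖p + (s * μ) • z - (a + s • w)‖
          + ENNReal.ofReal ‖ℓ' • u₂ - (s * μ) • z‖ :=
        add_le_add (pathELength_halfspaceUnion_le j (by simp [hw, hja]) (by simp [hjz, hjp])) hs'
      _ = _ := by
        rw [← norm_smul_sub_smul_eq hu₁ hu₂ hsnell, e1, e2, norm_smul, norm_smul,
          ← ENNReal.ofReal_add (by positivity) (by positivity), Real.norm_eq_abs, Real.norm_eq_abs,
          abs_of_nonneg hμ0, abs_of_nonneg (sub_nonneg.2 hμ1)]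
        congr 1
        ring

end Chains

section ShortestChains

variable {E : Type*} [NormedAddCommGroup E] {ι : Type*}

/-- The pairs `(a, ℓ)` such that `a` can be joined to `y` by at most `n` straight links, the
endpoints of each lying in a common member of the family `Φ`, of total length at most `ℓ`. -/
def chainSet (Φ : ι → Set E) (y : E) : ℕ → Set (E × ℝ)
  | 0 => {q | q.1 = y ∧ 0 ≤ q.2}
  | n + 1 => chainSet Φ y n ∪
      ⋃ i, {q | q.1 ∈ Φ i ∧ ∃ p ∈ Φ i, (p, q.2 - dist q.1 p) ∈ chainSet Φ y n}

theorem isClosed_chainSet [Finite ι] {Φ : ι → Set E} (hΦ : ∀ i, IsCompact (Φ i)) (y : E) (n : ℕ) :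
    IsClosed (chainSet Φ y n) := by
  induction n with
  | zero =>
    exact (isClosed_eq continuous_fst continuous_const).inter
      (isClosed_le continuous_const continuous_snd)
  | succ n ih =>
    refine ih.union (isClosed_iUnion_of_finite fun i => ?_)
    have : CompactSpace (Φ i) := isCompact_iff_compactSpace.1 (hΦ i)
    have hcl : IsClosed {z : Φ i × (E × ℝ) |
        ((z.1 : E), z.2.2 - dist z.2.1 z.1) ∈ chainSet Φ y n} :=
      ih.preimage (by fun_prop)
    have himage : {q : E × ℝ | ∃ p ∈ Φ i, (p, q.2 - dist q.1 p) ∈ chainSet Φ y n} =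
        Prod.snd '' {z : Φ i × (E × ℝ) | ((z.1 : E), z.2.2 - dist z.2.1 z.1) ∈ chainSet Φ y n} := by
      ext q
      constructor
      · rintro ⟨p, hp, h⟩
        exact ⟨(⟨p, hp⟩, q), h, rfl⟩
      · rintro ⟨⟨⟨p, hp⟩, q⟩, h, rfl⟩
        exact ⟨p, hp, h⟩
    have hclosed := isClosedMap_snd_of_compactSpace _ hcl
    rw [← himage] at hclosed
    exact ((hΦ i).isClosed.preimage continuous_fst).inter hclosed

theorem mem_chainSet_of_curve {Φ : ι → Set E} (hΦ : ∀ i, IsClosed (Φ i)) {y : E} {γ : ℝ → E} :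
    ∀ (n : ℕ) (J : Finset ι) (t₀ ℓ : ℝ), J.card = n → t₀ ≤ 1 → ContinuousOn γ (Icc t₀ 1) →
      γ 1 = y → (∀ t ∈ Icc t₀ 1, ∃ i ∈ J, γ t ∈ Φ i) → 0 ≤ ℓ →
      eVariationOn γ (Icc t₀ 1) ≤ ENNReal.ofReal ℓ → (γ t₀, ℓ) ∈ chainSet Φ y n := by
  classical
  intro n
  induction n with
  | zero =>
    intro J t₀ ℓ hJ ht₀ _ _ hJΦ
    obtain ⟨i, hi, -⟩ := hJΦ t₀ ⟨le_rfl, ht₀⟩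
    rw [Finset.card_eq_zero.1 hJ] at hi
    exact absurd hi (Finset.notMem_empty i)
  | succ n ih =>
    intro J t₀ ℓ hJ ht₀ hγ h1 hJΦ hℓ hvar
    obtain ⟨i, hi, hi0⟩ := hJΦ t₀ ⟨le_rfl, ht₀⟩
    have hpre : IsClosed (Icc t₀ 1 ∩ γ ⁻¹' Φ i) :=
      hγ.preimage_isClosed_of_isClosed isClosed_Icc (hΦ i)
    have hcomp : IsCompact (Icc t₀ 1 ∩ γ ⁻¹' Φ i) :=
      isCompact_Icc.of_isClosed_subset hpre inter_subset_left
    obtain ⟨t₁, ⟨ht₁, hΦ1⟩, hgr⟩ := hcomp.exists_isGreatest ⟨t₀, ⟨le_rfl, ht₀⟩, hi0⟩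
    have hsplit := eVariationOn.Icc_add_Icc γ (s := univ) ht₁.1 ht₁.2 (mem_univ _)
    simp only [univ_inter] at hsplit
    rw [← hsplit] at hvar
    have hd : edist (γ t₀) (γ t₁) ≤ eVariationOn γ (Icc t₀ t₁) :=
      eVariationOn.edist_le γ ⟨le_rfl, ht₁.1⟩ ⟨ht₁.1, le_rfl⟩
    rw [edist_dist] at hd
    have hle : dist (γ t₀) (γ t₁) ≤ ℓ :=
      (ENNReal.ofReal_le_ofReal_iff hℓ).1 (hd.trans (le_self_add.trans hvar))
    have hrest : eVariationOn γ (Icc t₁ 1) ≤ ENNReal.ofReal (ℓ - dist (γ t₀) (γ t₁)) := by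
      rw [ENNReal.ofReal_sub _ dist_nonneg]
      refine ENNReal.le_sub_of_add_le_left ENNReal.ofReal_ne_top ?_
      exact (add_le_add_left hd _).trans hvar
    refine Or.inr (mem_iUnion.2 ⟨i, hi0, γ t₁, hΦ1, ?_⟩)
    rcases ht₁.2.eq_or_lt with heq | hlt
    · have hz : (γ t₁, ℓ - dist (γ t₀) (γ t₁)) ∈ chainSet Φ y 0 :=
        ⟨by rw [heq, h1], sub_nonneg.2 hle⟩
      have hmono : Monotone (chainSet Φ y) := monotone_nat_of_le_succ fun _ => subset_union_left
      exact hmono (Nat.zero_le n) hz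
    · refine ih (J.erase i) t₁ _ (by rw [Finset.card_erase_of_mem hi, hJ]; rfl) ht₁.2
        (hγ.mono (Icc_subset_Icc_left ht₁.1)) h1 ?_ (sub_nonneg.2 hle) hrest
      have hIoc : ∀ t ∈ Ioc t₁ 1, γ t ∈ ⋃ k ∈ J.erase i, Φ k := fun t ht => by
        obtain ⟨k, hk, hkt⟩ := hJΦ t ⟨ht₁.1.trans ht.1.le, ht.2⟩
        refine mem_biUnion (Finset.mem_coe.2 (Finset.mem_erase.2 ⟨?_, hk⟩)) hkt
        rintro rfl
        exact absurd (hgr ⟨⟨ht₁.1.trans ht.1.le, ht.2⟩, hkt⟩) (not_le.2 ht.1)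
      have hclU : IsClosed (⋃ k ∈ J.erase i, Φ k) :=
        isClosed_biUnion_finset fun k _ => hΦ k
      have hmaps : MapsTo γ (closure (Ioc t₁ 1)) (⋃ k ∈ J.erase i, Φ k) := by
        have hc : ContinuousOn γ (closure (Ioc t₁ 1)) := by
          rw [closure_Ioc hlt.ne]
          exact hγ.mono (Icc_subset_Icc_left ht₁.1)
        have := MapsTo.closure_of_continuousOn hIoc hc
        rwa [hclU.closure_eq] at this
      intro t ht
      rw [← closure_Ioc hlt.ne] at ht
      simpa using hmaps ht

variable [InnerProductSpace ℝ E]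

theorem HyperplaneChain.of_mem_chainSet {g : ι → StrongDual ℝ E} {b : ι → ℝ} {Φ : ι → Set E}
    (hΦ : ∀ i, ∀ x ∈ Φ i, g i x = b i) {y : E} {n : ℕ} {a : E} {ℓ : ℝ}
    (h : (a, ℓ) ∈ chainSet Φ y n) : HyperplaneChain g b y a ℓ := by
  induction n generalizing a ℓ with
  | zero =>
    obtain ⟨rfl, h⟩ := h
    exact .nil h
  | succ n ih =>
    rcases h with h | h
    · exact ih h
    · obtain ⟨i, ha, p, hp, h⟩ := mem_iUnion.1 h
      simpa using HyperplaneChain.cons i (hΦ i a ha) (hΦ i p hp) (ih h)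

/-- On the boundary of a polyhedron, exterior distances are attained by chains of links in its
facet hyperplanes. -/
theorem exists_hyperplaneChain [Finite ι] [FiniteDimensional ℝ E] {g : ι → StrongDual ℝ E}
    {b : ι → ℝ} {a y : E} (ha : ∀ i, g i a ≤ b i) (hy : ∀ i, g i y ≤ b i)
    (hfin : pathELength (halfspaceUnion g b) a y ≠ ⊤) :
    HyperplaneChain g b y a (pathELength (halfspaceUnion g b) a y).toReal := by
  classical
  have := Fintype.ofFinite ι
  set L := (pathELength (halfspaceUnion g b) a y).toReal with hL
  have hL0 : 0 ≤ L := ENNReal.toReal_nonneg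
  set K : Set E := ⋂ i, {x | g i x ≤ b i} with hK
  set U : Set E := ⋂ i, {x | g i x < b i} with hU
  have hKcl : IsClosed K := isClosed_iInter fun i => isClosed_le (g i).continuous continuous_const
  have hKcv : Convex ℝ K := convex_iInter fun i => convex_halfSpace_le (g i).isLinear _
  have hUo : IsOpen U := isOpen_iInter_of_finite fun i =>
    isOpen_lt (g i).continuous continuous_const
  have hUK : U ⊆ K := iInter_mono fun i x (hx : g i x < b i) => hx.le
  have hUc : Uᶜ = halfspaceUnion g b := by
    ext x
    simp [hU, halfspaceUnion]
  have hlt : ∀ ε > 0, pathELength (K \ U) a y < ENNReal.ofReal (L + ε) := fun ε hε => by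
    refine (pathELength_diff_le hKcl hKcv hUo hUK (mem_iInter.2 ha) (mem_iInter.2 hy)).trans_lt ?_
    rw [hUc, ← ENNReal.ofReal_toReal hfin]
    exact (ENNReal.ofReal_lt_ofReal_iff (by linarith)).2 (by linarith)
  set Φ : ι → Set E := fun i => {x | g i x = b i} ∩ Metric.closedBall y (L + 1) with hΦ
  have hΦc : ∀ i, IsCompact (Φ i) := fun i => (isCompact_closedBall y (L + 1)).inter_left
    (isClosed_eq (g i).continuous continuous_const)
  have hmem : ∀ ε ∈ Ioo (0 : ℝ) 1, (a, L + ε) ∈ chainSet Φ y (Finset.univ : Finset ι).card := by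
    intro ε hε
    obtain ⟨γ, hγ, rfl, h1, hm, hvar⟩ := exists_curve_of_pathELength_lt (hlt ε hε.1)
    refine mem_chainSet_of_curve (fun i => (hΦc i).isClosed) _ Finset.univ 0 _ rfl zero_le_one hγ
      h1 (fun t ht => ?_) (by linarith [hε.1]) hvar.le
    obtain ⟨hmK, hmU⟩ := hm ht
    simp only [hK, hU, mem_iInter, mem_ofPred_eq, not_forall, not_lt] at hmK hmU
    obtain ⟨i, hi⟩ := hmU
    refine ⟨i, Finset.mem_univ i, le_antisymm (hmK i) hi, ?_⟩
    have hd := (eVariationOn.edist_le γ ht (right_mem_Icc.2 zero_le_one)).trans hvar.le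
    rw [edist_dist, h1, ENNReal.ofReal_le_ofReal_iff (by linarith [hε.1])] at hd
    exact Metric.mem_closedBall.2 (hd.trans (by linarith [hε.2]))
  have hlim : Tendsto (fun ε : ℝ => (a, L + ε)) (𝓝[>] 0) (𝓝 (a, L)) := by
    have : Continuous fun ε : ℝ => (a, L + ε) := by fun_prop
    simpa using (this.tendsto 0).mono_left nhdsWithin_le_nhds
  refine .of_mem_chainSet (Φ := Φ) (fun i x hx => hx.1)
    ((isClosed_chainSet hΦc y (Finset.univ : Finset ι).card).mem_of_tendsto hlim ?_)
  filter_upwards [Ioo_mem_nhdsGT (zero_lt_one' ℝ)] with ε hε using hmem ε hε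

end ShortestChains

section Concavity

/-- A continuous function with a strictly concave quadratic upper support at every interior point
of the unit interval lies above its chord. -/
theorem chord_le_of_eventually_le {φ : ℝ → ℝ} {q : ℝ} (hq : 0 < q) (hc : ContinuousOn φ (Icc 0 1))
    (h : ∀ τ ∈ Ioo (0 : ℝ) 1, ∃ m, ∀ᶠ s in 𝓝 (0 : ℝ), φ (τ + s) ≤ φ τ + s * m - q * s ^ 2)
    {τ : ℝ} (hτ : τ ∈ Icc (0 : ℝ) 1) : (1 - τ) * φ 0 + τ * φ 1 ≤ φ τ := by
  set ψ : ℝ → ℝ := fun t => φ t - ((1 - t) * φ 0 + t * φ 1) with hψ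
  obtain ⟨t, ht, hmin⟩ := isCompact_Icc.exists_isMinOn (nonempty_Icc.2 (zero_le_one' ℝ))
    (show ContinuousOn ψ (Icc 0 1) from hc.sub (by fun_prop))
  by_contra! hlt
  have hneg : ψ t < 0 := (hmin hτ).trans_lt (sub_neg.2 hlt)
  have h0 : t ≠ 0 := by rintro rfl; simp [hψ] at hneg
  have h1 : t ≠ 1 := by rintro rfl; simp [hψ] at hneg
  have ht' : t ∈ Ioo (0 : ℝ) 1 := ⟨ht.1.lt_of_ne' h0, ht.2.lt_of_ne h1⟩
  obtain ⟨m, hm⟩ := h t ht'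
  have hev : ∀ᶠ s in 𝓝 (0 : ℝ), t + s ∈ Icc (0 : ℝ) 1 := by
    have hcont : Continuous fun s : ℝ => t + s := by fun_prop
    exact hcont.continuousAt.eventually_mem (by simpa using Icc_mem_nhds ht'.1 ht'.2)
  have hnn : ∀ᶠ s in 𝓝 (0 : ℝ), 0 ≤ s * (m - (φ 1 - φ 0)) + s ^ 2 * (-q) := by
    filter_upwards [hm, hev] with s hs hmem
    have hmi : ψ t ≤ ψ (t + s) := hmin hmem
    simp only [hψ] at hmi
    linarith
  rw [eq_zero_of_eventually_nonneg hnn] at hnn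
  obtain ⟨s, hs, hs0⟩ :=
    ((hnn.filter_mono nhdsWithin_le_nhds).and (self_mem_nhdsWithin (s := Ioi (0 : ℝ)))).exists
  have hs0 : 0 < s := hs0
  have : 0 < s ^ 2 * q := by positivity
  linarith

variable {E : Type*} [NormedAddCommGroup E] [InnerProductSpace ℝ E] {ι : Type*}

/-- The points `x + τ • v + h τ • e`, `τ ∈ [0, 1]`, lie on the lower boundary (with respect to the
direction `e`) of the polyhedron `{z | ∀ i, g i z ≤ b i}`, and the facets through them have slope
at most `K` in the direction `v`. -/
structure IsLowerProfile (g : ι → StrongDual ℝ E) (b : ι → ℝ) (x v e : E) (h : ℝ → ℝ) (K : ℝ) :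
    Prop where
  le : ∀ τ ∈ Icc (0 : ℝ) 1, ∀ i, g i (x + τ • v + h τ • e) ≤ b i
  exists_eq : ∀ τ ∈ Icc (0 : ℝ) 1, ∃ i, g i (x + τ • v + h τ • e) = b i
  neg : ∀ τ ∈ Icc (0 : ℝ) 1, ∀ i, g i (x + τ • v + h τ • e) = b i → g i e < 0
  slope : ∀ τ ∈ Icc (0 : ℝ) 1, ∀ i, g i (x + τ • v + h τ • e) = b i → |g i v| ≤ K * -g i e

namespace IsLowerProfile

variable {g : ι → StrongDual ℝ E} {b : ι → ℝ} {x v e y : E} {h : ℝ → ℝ} {K : ℝ}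

theorem exists_slope (H : IsLowerProfile g b x v e h K) (he : ‖e‖ = 1) {τ : ℝ}
    (hτ : τ ∈ Icc (0 : ℝ) 1) {i : ι} (hi : g i (x + τ • v + h τ • e) = b i) :
    ∃ l : ℝ, |l| ≤ K ∧ g i (v + l • e) = 0 ∧ ∀ τ' ∈ Icc (0 : ℝ) 1,
      0 ≤ h τ' - h τ - l * (τ' - τ) ∧
      pathELength (halfspaceUnion g b) (x + τ' • v + h τ' • e)
        (x + τ • v + h τ • e + (τ' - τ) • (v + l • e)) ≤
        ENNReal.ofReal (h τ' - h τ - l * (τ' - τ)) := by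
  have hneg := H.neg τ hτ i hi
  have hsl := H.slope τ hτ i hi
  refine ⟨-(g i v / g i e), ?_, ?_, fun τ' hτ' => ?_⟩
  · rwa [abs_neg, abs_div, abs_of_neg hneg, div_le_iff₀ (neg_pos.2 hneg)]
  · simp only [map_add, map_smul, smul_eq_mul]
    field_simp [hneg.ne]
    ring
  set l : ℝ := -(g i v / g i e) with hl
  have hlv : l * g i e = -g i v := by rw [hl]; field_simp [hneg.ne]
  have hc : 0 ≤ h τ' - h τ - l * (τ' - τ) := by
    have h1 := H.le τ' hτ' i
    rw [← hi] at h1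
    simp only [map_add, map_smul, smul_eq_mul] at h1
    by_contra! hlt
    have h2 := mul_pos_of_neg_of_neg hlt hneg
    have h3 : (h τ' - h τ - l * (τ' - τ)) * g i e = (h τ' - h τ) * g i e + (τ' - τ) * g i v := by
      linear_combination -(τ' - τ) * hlv
    linarith
  refine ⟨hc, ?_⟩
  obtain ⟨j, hj⟩ := H.exists_eq τ' hτ'
  have hjneg := H.neg τ' hτ' j hj
  have heq : x + τ • v + h τ • e + (τ' - τ) • (v + l • e) =
      x + τ' • v + h τ' • e + (-(h τ' - h τ - l * (τ' - τ))) • e := by module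
  rw [heq]
  refine (pathELength_halfspaceUnion_le j hj.ge ?_).trans_eq ?_
  · rw [map_add, map_smul, smul_eq_mul, hj]
    nlinarith
  · rw [add_sub_cancel_left, norm_smul, he, mul_one, norm_neg, Real.norm_of_nonneg hc]

theorem abs_sub_le (H : IsLowerProfile g b x v e h K) (he : ‖e‖ = 1) {τ τ' : ℝ}
    (hτ : τ ∈ Icc (0 : ℝ) 1) (hτ' : τ' ∈ Icc (0 : ℝ) 1) : |h τ' - h τ| ≤ K * |τ' - τ| := by
  have key : ∀ {τ τ' : ℝ}, τ ∈ Icc (0 : ℝ) 1 → τ' ∈ Icc (0 : ℝ) 1 →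
      h τ - h τ' ≤ K * |τ' - τ| := by
    intro τ τ' hτ hτ'
    obtain ⟨i, hi⟩ := H.exists_eq τ hτ
    obtain ⟨l, hl, -, h1⟩ := H.exists_slope he hτ hi
    have h2 : |l * (τ' - τ)| ≤ K * |τ' - τ| := by rw [abs_mul]; gcongr
    linarith [(h1 τ' hτ').1, neg_abs_le (l * (τ' - τ))]
  rw [abs_le]
  have := key hτ' hτ
  rw [abs_sub_comm] at this
  constructor <;> linarith [key hτ hτ']

theorem pathELength_le (H : IsLowerProfile g b x v e h K) (he : ‖e‖ = 1) {τ τ' : ℝ}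
    (hτ : τ ∈ Icc (0 : ℝ) 1) (hτ' : τ' ∈ Icc (0 : ℝ) 1) :
    pathELength (halfspaceUnion g b) (x + τ' • v + h τ' • e) (x + τ • v + h τ • e) ≤
      ENNReal.ofReal ((‖v‖ + 3 * K) * |τ' - τ|) := by
  obtain ⟨i, hi⟩ := H.exists_eq τ hτ
  obtain ⟨l, hl, hw, h1⟩ := H.exists_slope he hτ hi
  obtain ⟨hc, h2⟩ := h1 τ' hτ'
  have h3 : pathELength (halfspaceUnion g b)
      (x + τ • v + h τ • e + (τ' - τ) • (v + l • e)) (x + τ • v + h τ • e) ≤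
      ENNReal.ofReal (‖v + l • e‖ * |τ' - τ|) := by
    refine (pathELength_halfspaceUnion_le i ?_ hi.ge).trans_eq ?_
    · rw [map_add, map_smul, hw, hi, smul_zero, add_zero]
    · rw [sub_add_cancel_left, norm_neg, norm_smul, Real.norm_eq_abs, mul_comm]
  refine (pathELength_triangle _ _ _ _).trans ((add_le_add h2 h3).trans ?_)
  rw [← ENNReal.ofReal_add hc (by positivity)]
  refine ENNReal.ofReal_le_ofReal ?_
  have h4 : ‖v + l • e‖ ≤ ‖v‖ + K := by
    refine (norm_add_le _ _).trans ?_
    rw [norm_smul, he, mul_one, Real.norm_eq_abs]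
    gcongr
  have h5 := (abs_le.1 (H.abs_sub_le he hτ hτ')).2
  have h6 : |l * (τ' - τ)| ≤ K * |τ' - τ| := by rw [abs_mul]; gcongr
  have h7 : ‖v + l • e‖ * |τ' - τ| ≤ (‖v‖ + K) * |τ' - τ| := by gcongr
  linarith [neg_abs_le (l * (τ' - τ))]

theorem pathELength_ne_top (H : IsLowerProfile g b x v e h K) (he : ‖e‖ = 1) {τ τ' : ℝ}
    (hτ : τ ∈ Icc (0 : ℝ) 1) (hτ' : τ' ∈ Icc (0 : ℝ) 1)
    (hfin : pathELength (halfspaceUnion g b) (x + τ • v + h τ • e) y ≠ ⊤) :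
    pathELength (halfspaceUnion g b) (x + τ' • v + h τ' • e) y ≠ ⊤ :=
  ((pathELength_triangle _ _ (x + τ • v + h τ • e) _).trans_lt (ENNReal.add_lt_top.2
    ⟨(H.pathELength_le he hτ hτ').trans_lt ENNReal.ofReal_lt_top, hfin.lt_top⟩)).ne

theorem chord_le [Finite ι] [FiniteDimensional ℝ E] (H : IsLowerProfile g b x v e h K)
    (he : ‖e‖ = 1) (hy : ∀ i, g i y ≤ b i) {δ κ : ℝ} (hδ : 0 < δ)
    (hdist : ∀ τ ∈ Icc (0 : ℝ) 1, δ ≤ dist (x + τ • v + h τ • e) y)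
    (hκ : (‖v‖ + K) ^ 2 < 2 * κ * δ)
    (hfin : ∀ τ ∈ Icc (0 : ℝ) 1,
      pathELength (halfspaceUnion g b) (x + τ • v + h τ • e) y ≠ ⊤) {φ : ℝ → ℝ}
    (hφ : ∀ τ, φ τ = (pathELength (halfspaceUnion g b) (x + τ • v + h τ • e) y).toReal
      - h τ - κ * τ ^ 2) {τ : ℝ} (hτ : τ ∈ Icc (0 : ℝ) 1) :
    (1 - τ) * φ 0 + τ * φ 1 ≤ φ τ := by
  set D : ℝ → ℝ := fun τ => (pathELength (halfspaceUnion g b) (x + τ • v + h τ • e) y).toReal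
    with hD
  obtain rfl : φ = fun τ => D τ - h τ - κ * τ ^ 2 := funext hφ
  have hDle : ∀ {τ : ℝ} {p : E} {r r' : ℝ}, τ ∈ Icc (0 : ℝ) 1 → 0 ≤ r → 0 ≤ r' →
      pathELength (halfspaceUnion g b) (x + τ • v + h τ • e) p ≤ ENNReal.ofReal r →
      pathELength (halfspaceUnion g b) p y ≤ ENNReal.ofReal r' → D τ ≤ r + r' := by
    intro τ p r r' hτ hr hr' h1 h2
    refine ENNReal.toReal_le_of_le_ofReal (add_nonneg hr hr') ?_
    rw [ENNReal.ofReal_add hr hr']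
    exact (pathELength_triangle _ _ p _).trans (add_le_add h1 h2)
  have hK : 0 ≤ K := by
    have := H.abs_sub_le he (left_mem_Icc.2 zero_le_one) (right_mem_Icc.2 (zero_le_one' ℝ))
    simpa using (abs_nonneg _).trans this
  have hDlip : ContinuousOn D (Icc 0 1) := by
    refine (LipschitzOnWith.of_le_add_mul (Real.toNNReal (‖v‖ + 3 * K))
      fun τ hτ τ' hτ' => ?_).continuousOn
    rw [Real.coe_toNNReal _ (by positivity), Real.dist_eq, add_comm]
    exact hDle hτ (by positivity) ENNReal.toReal_nonneg (H.pathELength_le he hτ' hτ)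
      (ENNReal.ofReal_toReal (hfin τ' hτ')).ge
  have hhlip : ContinuousOn h (Icc 0 1) := by
    refine (LipschitzOnWith.of_dist_le_mul (K := Real.toNNReal K)
      fun τ hτ τ' hτ' => ?_).continuousOn
    rw [Real.coe_toNNReal _ hK, Real.dist_eq, Real.dist_eq]
    exact H.abs_sub_le he hτ' hτ
  refine chord_le_of_eventually_le (φ := fun τ => D τ - h τ - κ * τ ^ 2)
    (q := κ - (‖v‖ + K) ^ 2 / (2 * δ)) ?_
    (by fun_prop) (fun τ hτ => ?_) hτ
  · rw [sub_pos, div_lt_iff₀ (by positivity)]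
    linarith
  have hτI := Ioo_subset_Icc_self hτ
  have hL : δ ≤ D τ := by
    refine (hdist τ hτI).trans ?_
    rw [← ENNReal.ofReal_le_iff_le_toReal (hfin τ hτI), ← edist_dist]
    exact edist_le_pathELength _ _ _
  have hay : x + τ • v + h τ • e ≠ y := fun heq => by
    have := hdist τ hτI
    rw [heq, dist_self] at this
    linarith
  obtain ⟨i, u, hu, hi, hvar⟩ := (exists_hyperplaneChain (H.le τ hτI) hy
    (hfin τ hτI)).exists_variation (ENNReal.ofReal_toReal (hfin τ hτI)).le hay
  obtain ⟨l, hl, hw, h1⟩ := H.exists_slope he hτI hi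
  have hev : ∀ᶠ s in 𝓝 (0 : ℝ), τ + s ∈ Icc (0 : ℝ) 1 := by
    have hcont : Continuous fun s : ℝ => τ + s := by fun_prop
    exact hcont.continuousAt.eventually_mem (by simpa using Icc_mem_nhds hτ.1 hτ.2)
  refine ⟨-inner ℝ u (v + l • e) - l - 2 * κ * τ, ?_⟩
  filter_upwards [hvar _ hw, hev] with s hs hmem
  obtain ⟨hc, h2⟩ := h1 _ hmem
  rw [add_sub_cancel_left] at hc h2
  have h3 := hDle hmem hc (norm_nonneg _) h2 hs
  have h4 := norm_smul_add_smul_le (z := v + l • e) hu (hδ.trans_le hL) (-s)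
  rw [neg_smul, ← sub_eq_add_neg] at h4
  have h5 : ‖v + l • e‖ ≤ ‖v‖ + K := by
    refine (norm_add_le _ _).trans ?_
    rw [norm_smul, he, mul_one, Real.norm_eq_abs]
    gcongr
  have h6 : ‖v + l • e‖ ^ 2 / (2 * D τ) ≤ (‖v‖ + K) ^ 2 / (2 * δ) := by gcongr
  have h7 := mul_le_mul_of_nonneg_left h6 (sq_nonneg s)
  rw [neg_sq] at h4
  have h8 := h3.trans (add_le_add_right h4 _)
  linarith

end IsLowerProfile

end Concavity

section Approximation

variable {E : Type*} [NormedAddCommGroup E] [InnerProductSpace ℝ E]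

theorem pathELength_halfspaceUnion_le_homothety {ι : Type*} {g : ι → StrongDual ℝ E} {b : ι → ℝ}
    {X : Set E} {c : E} {ε : ℝ} (hε : 0 < ε)
    (hX : ∀ p ∈ X, ∃ i, b i ≤ g i (p + ε • (p - c))) {a z : E}
    (ha : ∃ i, b i ≤ g i a ∧ b i ≤ g i (a + ε • (a - c)))
    (hz : ∃ i, b i ≤ g i z ∧ b i ≤ g i (z + ε • (z - c))) :
    pathELength (halfspaceUnion g b) a z ≤ ENNReal.ofReal (1 + ε) * pathELength X a z +
      ENNReal.ofReal (ε * (‖a - c‖ + ‖z - c‖)) := by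
  have hlip : LipschitzOnWith (Real.toNNReal (1 + ε)) (fun p => p + ε • (p - c)) X := by
    refine LipschitzOnWith.of_dist_le_mul fun p _ q _ => ?_
    rw [dist_eq_norm, dist_eq_norm, Real.coe_toNNReal _ (by positivity)]
    have : p + ε • (p - c) - (q + ε • (q - c)) = (1 + ε) • (p - q) := by module
    rw [this, norm_smul, Real.norm_of_nonneg (by positivity)]
  have h1 := pathELength_image_le (T := halfspaceUnion g b)
    (Real.toNNReal_pos.2 (by positivity)).ne' hlip hX a z
  obtain ⟨i, hi, hi'⟩ := ha
  obtain ⟨j, hj, hj'⟩ := hz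
  have h2 := pathELength_halfspaceUnion_le i hi hi'
  have h3 := pathELength_halfspaceUnion_le j hj' hj
  rw [add_sub_cancel_left, norm_smul, Real.norm_of_nonneg hε.le] at h2
  rw [sub_add_cancel_left, norm_neg, norm_smul, Real.norm_of_nonneg hε.le] at h3
  calc pathELength (halfspaceUnion g b) a z
      ≤ ENNReal.ofReal (ε * ‖a - c‖) + (ENNReal.ofReal (1 + ε) * pathELength X a z +
        ENNReal.ofReal (ε * ‖z - c‖)) :=
        (pathELength_triangle _ _ _ _).trans
          (add_le_add h2 ((pathELength_triangle _ _ _ _).trans (add_le_add h1 h3)))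
    _ = _ := by
        rw [mul_add, ENNReal.ofReal_add (p := ε * ‖a - c‖) (by positivity) (by positivity)]
        ring

theorem IsConvexBody.le_of_interior_le {C : Set E} (hC : IsConvexBody C) {g : StrongDual ℝ E}
    {b : ℝ} (h : ∀ c ∈ interior C, g c < b) : ∀ c ∈ C, g c ≤ b := fun c hc => by
  have hcl : IsClosed {c | g c ≤ b} := isClosed_le g.continuous continuous_const
  have hsub : closure (interior C) ⊆ {c | g c ≤ b} :=
    closure_minimal (fun c hc => (h c hc).le) hcl
  refine hsub ?_
  rw [hC.2.1.closure_interior_eq_closure_of_nonempty_interior hC.2.2]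
  exact subset_closure hc

/-- Approximation of a convex body by circumscribed polyhedra, with control of the exterior
distances between finitely many boundary points. -/
theorem IsConvexBody.exists_polyhedral_approximation [CompleteSpace E] {C : Set E}
    (hC : IsConvexBody C) {c : E} (hc : c ∈ interior C) {ε : ℝ} (hε : 0 < ε) {S : Finset E}
    (hS : ∀ s ∈ S, s ∈ frontier C) :
    ∃ (T : Finset E) (g : T → StrongDual ℝ E) (b : T → ℝ),
      (∀ i, ∀ p ∈ interior C, g i p < b i) ∧ (∀ s ∈ S, ∃ i, g i s = b i) ∧
      (∀ a ∈ frontier C, ∀ z ∈ frontier C,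
        pathELength (frontier C) a z ≤ pathELength (halfspaceUnion g b) a z) ∧
      ∀ a ∈ S, ∀ z ∈ S, pathELength (halfspaceUnion g b) a z ≤
        ENNReal.ofReal (1 + ε) * pathELength (frontier C) a z +
          ENNReal.ofReal (ε * (‖a - c‖ + ‖z - c‖)) := by
  classical
  have hcl : IsClosed C := hC.1.isClosed
  have hfr : frontier C = C \ interior C := hcl.frontier_eq
  have hex : ∀ p : E, ∃ f : StrongDual ℝ E, p ∈ frontier C → ∀ q ∈ interior C, f q < f p := by
    intro p
    by_cases hp : p ∈ frontier C
    · rw [hfr] at hp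
      obtain ⟨f, hf⟩ := geometric_hahn_banach_open_point hC.2.1.interior isOpen_interior hp.2
      exact ⟨f, fun _ => hf⟩
    · exact ⟨0, fun h => absurd h hp⟩
  choose f hf using hex
  have hpush : ∀ q ∈ frontier C, f q q < f q (q + ε • (q - c)) := fun q hq => by
    have := mul_pos hε (sub_pos.2 (hf q hq c hc))
    rw [map_add, map_smul, map_sub, smul_eq_mul]
    linarith
  obtain ⟨T₀, hT₀, hcov⟩ := (hC.1.of_isClosed_subset isClosed_frontier
      hcl.frontier_subset).elim_nhds_subcover
    (fun q => {p | f q q < f q (p + ε • (p - c))}) fun q hq =>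
      (isOpen_lt continuous_const (by fun_prop)).mem_nhds (hpush q hq)
  have hT : ∀ q ∈ T₀ ∪ S, q ∈ frontier C := fun q hq =>
    (Finset.mem_union.1 hq).elim (hT₀ q) (hS q)
  refine ⟨T₀ ∪ S, fun q => f q, fun q => f q q, fun i => hf _ (hT _ i.2),
    fun s hs => ⟨⟨s, Finset.mem_union_right _ hs⟩, rfl⟩, fun a ha z hz => ?_, fun a ha z hz => ?_⟩
  · rw [hfr] at ha hz
    rw [hfr]
    refine (pathELength_diff_le hcl hC.2.1 isOpen_interior interior_subset ha.1 hz.1).trans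
      (pathELength_mono ?_ _ _)
    rintro x ⟨i, hi⟩ hx
    exact (hf _ (hT _ i.2) x hx).not_ge hi
  · refine pathELength_halfspaceUnion_le_homothety hε (fun p hp => ?_) ?_ ?_
    · obtain ⟨q, hq, hqp⟩ := mem_iUnion₂.1 (hcov hp)
      exact ⟨⟨q, Finset.mem_union_left _ hq⟩, hqp.le⟩
    · exact ⟨⟨a, Finset.mem_union_right _ ha⟩, le_rfl, (hpush a (hS a ha)).le⟩
    · exact ⟨⟨z, Finset.mem_union_right _ hz⟩, le_rfl, (hpush z (hS z hz)).le⟩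

end Approximation

section LowerChart

variable {E : Type*} [NormedAddCommGroup E] [InnerProductSpace ℝ E]

theorem exists_lowest_point {ι : Type*} [Finite ι] (g : ι → StrongDual ℝ E) (b : ι → ℝ) {e : E}
    (hne : ∃ i, g i e < 0) (z : E) :
    ∃ t : ℝ, (∀ i, g i e < 0 → g i (z + t • e) ≤ b i) ∧
      ∃ i, g i e < 0 ∧ g i (z + t • e) = b i := by
  obtain ⟨i, hi, hmax⟩ := Set.exists_max_image {i | g i e < 0}
    (fun i => (b i - g i z) / g i e) (Set.toFinite _) hne
  have hi : g i e < 0 := hi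
  refine ⟨(b i - g i z) / g i e, fun j hj => ?_, i, hi, ?_⟩
  · have h := hmax j hj
    rw [div_le_iff_of_neg hj] at h
    rw [map_add, map_smul, smul_eq_mul]
    linarith
  · rw [map_add, map_smul, smul_eq_mul, div_mul_cancel₀ _ hi.ne]
    ring

/-- Over the ball `Metric.ball x₀ r` of the subspace `H`, the graph of `f` in the direction `e` is
a `K`-Lipschitz part of the boundary of `C`, with the interior of `C` above it. -/
structure IsLowerChart (C : Set E) {H : Submodule ℝ E} (e : E) (f : H → ℝ) (K : ℝ) (x₀ : H)
    (r : ℝ) : Prop where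
  norm_eq : ‖e‖ = 1
  mem : ∀ x ∈ Metric.ball x₀ r, (x : E) + f x • e ∈ frontier C
  above : ∀ x ∈ Metric.ball x₀ r, ∃ t > f x, (x : E) + t • e ∈ interior C
  lip : ∀ x ∈ Metric.ball x₀ r, ∀ x' ∈ Metric.ball x₀ r, |f x - f x'| ≤ K * ‖x - x'‖

variable {C : Set E} {H : Submodule ℝ E} {e : E} {f : H → ℝ} {K : ℝ} {x₀ : H} {ρ : ℝ}

theorem IsLowerChart.neg_of_eq {r : ℝ} (hc : IsLowerChart C e f K x₀ r) {g : StrongDual ℝ E}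
    {b : ℝ} (hg : ∀ p ∈ interior C, g p < b) {x : H} (hx : x ∈ Metric.ball x₀ r) {t : ℝ}
    (ht : t ≤ f x) (h : g (x + t • e) = b) : g e < 0 := by
  obtain ⟨s, hs, hmem⟩ := hc.above x hx
  have h1 := hg _ hmem
  rw [← h] at h1
  simp only [map_add, map_smul, smul_eq_mul] at h1
  by_contra! h2
  nlinarith [mul_nonneg (sub_nonneg.2 (ht.trans hs.le)) h2]

theorem IsLowerChart.exists_profile (hc : IsLowerChart C e f K x₀ (2 * ρ)) (hC : IsConvexBody C)
    (hK : 0 ≤ K) (hρ : 0 < ρ) {ι : Type*} [Finite ι] {g : ι → StrongDual ℝ E} {b : ι → ℝ}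
    (hg : ∀ i, ∀ p ∈ interior C, g i p < b i) {x v : H} (hv : v ≠ 0)
    (hx : ∀ t ∈ Icc (0 : ℝ) 1, x + t • v ∈ Metric.ball x₀ ρ)
    (h0 : ∃ i, g i (x + f x • e) = b i) :
    ∃ h : ℝ → ℝ, IsLowerProfile g b x v e h (5 * K * ‖v‖) ∧
      (∀ t ∈ Icc (0 : ℝ) 1, |h t - f x₀| ≤ 5 * K * ρ) ∧
      ∀ t ∈ Icc (0 : ℝ) 1, (∃ i, g i ((x + t • v : H) + f (x + t • v) • e) = b i) →
        h t = f (x + t • v) := by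
  have hball : Metric.ball x₀ ρ ⊆ Metric.ball x₀ (2 * ρ) := Metric.ball_subset_ball (by linarith)
  have hx0 : x ∈ Metric.ball x₀ ρ := by simpa using hx 0 (by simp)
  have hle : ∀ p ∈ Metric.ball x₀ (2 * ρ), ∀ i, g i (p + f p • e) ≤ b i := fun p hp i =>
    hC.le_of_interior_le (hg i) _ (hC.1.isClosed.frontier_subset (hc.mem p hp))
  have hv0 : 0 < ‖v‖ := norm_pos_iff.2 hv
  have hvρ : ‖v‖ ≤ 2 * ρ := by
    have h1 : x + v ∈ Metric.ball x₀ ρ := by simpa using hx 1 (by simp)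
    have := dist_triangle_right (x + v) x x₀
    rw [dist_eq_norm, add_sub_cancel_left] at this
    linarith [Metric.mem_ball.1 h1, Metric.mem_ball.1 hx0]
  have hslope : ∀ p ∈ Metric.ball x₀ ρ, ∀ i, ∀ t ≤ f p, g i (p + t • e) = b i →
      ρ * |g i v| ≤ ‖v‖ * ((K * ρ + f p - t) * -g i e) := by
    intro p hp i t ht hi
    have hneg := hc.neg_of_eq (hg i) (hball hp) ht hi
    have key : ∀ σ : ℝ, |σ| * ‖v‖ = ρ → σ * g i v ≤ (K * ρ + f p - t) * -g i e := by
      intro σ hσ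
      have hσn : ‖σ • v‖ = ρ := by rw [norm_smul, Real.norm_eq_abs, hσ]
      have hmem : p + σ • v ∈ Metric.ball x₀ (2 * ρ) := by
        refine Metric.mem_ball.2 ((dist_triangle _ p _).trans_lt ?_)
        rw [dist_eq_norm, add_sub_cancel_left, hσn]
        linarith [Metric.mem_ball.1 hp]
      have h1 := hle _ hmem i
      have h2 := (abs_le.1 (hc.lip _ hmem _ (hball hp))).2
      rw [add_sub_cancel_left, hσn] at h2
      rw [← hi] at h1
      simp only [Submodule.coe_add, Submodule.coe_smul, map_add, map_smul, smul_eq_mul] at h1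
      have h3 := mul_le_mul_of_nonneg_right h2 (neg_pos.2 hneg).le
      linarith
    have hp1 := key (ρ / ‖v‖) (by rw [abs_of_pos (by positivity)]; field_simp)
    have hp2 := key (-(ρ / ‖v‖)) (by rw [abs_neg, abs_of_pos (by positivity)]; field_simp)
    have h3 : ρ / ‖v‖ * |g i v| ≤ (K * ρ + f p - t) * -g i e := by
      rcases abs_cases (g i v) with ⟨h, -⟩ | ⟨h, -⟩ <;> rw [h] <;> linarith
    rw [div_mul_eq_mul_div, div_le_iff₀ hv0] at h3
    linarith
  obtain ⟨j, hj⟩ := h0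
  have hjneg := hc.neg_of_eq (hg j) (hball hx0) le_rfl hj
  choose h hh1 hh2 using fun t : ℝ => exists_lowest_point g b ⟨j, hjneg⟩ ((x : E) + t • (v : E))
  have hcoe : ∀ (t s : ℝ), ((x + t • v : H) : E) + s • e = x + t • (v : E) + s • e := fun _ _ => rfl
  have hhf : ∀ t ∈ Icc (0 : ℝ) 1, h t ≤ f (x + t • v) := by
    intro t ht
    obtain ⟨i, hi, hi'⟩ := hh2 t
    have h1 := hle _ (hball (hx t ht)) i
    rw [hcoe, ← hi', map_add, map_add _ _ (h t • e), map_smul, map_smul, smul_eq_mul,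
      smul_eq_mul] at h1
    by_contra! hlt
    nlinarith
  have hfh : ∀ t ∈ Icc (0 : ℝ) 1, f (x + t • v) - h t ≤ 4 * K * ρ := by
    intro t ht
    have h1 := hslope x hx0 j _ le_rfl hj
    have h2 : |g j v| ≤ K * ‖v‖ * -g j e := by
      rw [add_sub_cancel_right] at h1
      refine le_of_mul_le_mul_left ?_ hρ
      linarith
    have h3 := hh1 t j hjneg
    rw [← hj] at h3
    simp only [map_add, map_smul, smul_eq_mul] at h3
    have h4 : |t * g j v| ≤ K * ‖v‖ * -g j e := by
      rw [abs_mul, abs_of_nonneg ht.1]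
      exact (mul_le_of_le_one_left (abs_nonneg _) ht.2).trans h2
    have h5 : f x - h t ≤ K * ‖v‖ := by
      refine le_of_mul_le_mul_right ?_ (neg_pos.2 hjneg)
      linarith [neg_abs_le (t * g j v)]
    have h6 := (abs_le.1 (hc.lip _ (hball (hx t ht)) _ (hball hx0))).2
    rw [add_sub_cancel_left, norm_smul, Real.norm_of_nonneg ht.1] at h6
    have h7 : K * (t * ‖v‖) ≤ K * (2 * ρ) :=
      mul_le_mul_of_nonneg_left ((mul_le_of_le_one_left (norm_nonneg _) ht.2).trans hvρ) hK
    have h8 : K * ‖v‖ ≤ K * (2 * ρ) := by gcongr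
    linarith
  have hP : ∀ t ∈ Icc (0 : ℝ) 1, ∀ i, g i ((x : E) + t • (v : E) + h t • e) ≤ b i := by
    intro t ht i
    rcases lt_or_ge (g i e) 0 with hi | hi
    · exact hh1 t i hi
    · have h1 := hle _ (hball (hx t ht)) i
      rw [hcoe, map_add, map_smul, smul_eq_mul] at h1
      rw [map_add, map_smul, smul_eq_mul]
      nlinarith [mul_le_mul_of_nonneg_right (hhf t ht) hi]
  have hneg : ∀ t ∈ Icc (0 : ℝ) 1, ∀ i, g i ((x : E) + t • (v : E) + h t • e) = b i → g i e < 0 :=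
    fun t ht i hi => hc.neg_of_eq (hg i) (hball (hx t ht)) (hhf t ht) hi
  refine ⟨h, ⟨hP, fun t _ => (hh2 t).imp fun i hi => hi.2, hneg, fun t ht i hi => ?_⟩,
    fun t ht => ?_, fun t ht ⟨i, hi⟩ => ?_⟩
  · have h1 := hslope _ (hx t ht) i _ (hhf t ht) hi
    have h2 : (K * ρ + f (x + t • v) - h t) * -g i e ≤ 5 * K * ρ * -g i e :=
      mul_le_mul_of_nonneg_right (by linarith [hfh t ht]) (neg_pos.2 (hneg t ht i hi)).le
    have h3 := mul_le_mul_of_nonneg_left h2 hv0.le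
    refine le_of_mul_le_mul_left ?_ hρ
    linarith
  · have h1 := hc.lip _ (hball (hx t ht)) x₀ (Metric.mem_ball_self (by linarith))
    have h2 : K * ‖x + t • v - x₀‖ ≤ K * ρ := by
      gcongr
      rw [← dist_eq_norm]
      exact (Metric.mem_ball.1 (hx t ht)).le
    have h3 := abs_le.1 (h1.trans h2)
    have h4 : 0 ≤ K * ρ := by positivity
    rw [abs_le]
    constructor <;> linarith [hfh t ht, hhf t ht]
  · refine (hhf t ht).antisymm ?_
    have hineg := hc.neg_of_eq (hg i) (hball (hx t ht)) le_rfl hi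
    have h1 := hh1 t i hineg
    rw [← hi, hcoe, map_add, map_add _ _ (f _ • e), map_smul, map_smul, smul_eq_mul,
      smul_eq_mul] at h1
    by_contra! hlt
    nlinarith

end LowerChart

section ChartConcavity

variable {E : Type*} [NormedAddCommGroup E] [InnerProductSpace ℝ E] [FiniteDimensional ℝ E]
  {C : Set E} {H : Submodule ℝ E} {e : E} {f : H → ℝ} {K : ℝ} {x₀ : H} {ρ : ℝ}

/-- In a chart, distance functions to boundary points at a definite distance become concave after
subtraction of the function defining the chart and of a definite multiple of the squared norm. -/
theorem IsLowerChart.concaveOn_intrinsicDist (hc : IsLowerChart C e f K x₀ (2 * ρ))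
    (hC : IsConvexBody C) (hK : 0 ≤ K) (hρ : 0 < ρ) {y : E} (hy : y ∈ frontier C) {δ κ : ℝ}
    (hδ : 0 < δ) (hρδ : ρ * (1 + 5 * K) ≤ δ) (hκ : (1 + 5 * K) ^ 2 < 2 * κ * δ)
    (hyd : 2 * δ ≤ dist (x₀ + f x₀ • e) y) :
    ConcaveOn ℝ (Metric.ball x₀ ρ)
      fun x => intrinsicDist (frontier C) (x + f x • e) y - (f x + κ * ‖x‖ ^ 2) := by
  classical
  refine ⟨convex_ball _ _, fun x₁ hx₁ x₂ hx₂ a t ha ht hat => ?_⟩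
  obtain rfl : a = 1 - t := by linarith
  obtain ⟨v, rfl⟩ : ∃ v, x₂ = x₁ + v := ⟨x₂ - x₁, by abel⟩
  have hcomb : (1 - t) • x₁ + t • (x₁ + v) = x₁ + t • v := by module
  rw [hcomb]
  rcases eq_or_ne v 0 with rfl | hv
  · simp only [smul_zero, add_zero, smul_eq_mul]
    linarith
  have hmemball : ∀ s ∈ Icc (0 : ℝ) 1, x₁ + s • v ∈ Metric.ball x₀ ρ := fun s hs =>
    (convex_ball x₀ ρ).add_smul_mem hx₁ hx₂ hs
  have htI : t ∈ Icc (0 : ℝ) 1 := ⟨ht, by linarith⟩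
  have hball : Metric.ball x₀ ρ ⊆ Metric.ball x₀ (2 * ρ) := Metric.ball_subset_ball (by linarith)
  have hfr : ∀ p ∈ Metric.ball x₀ ρ, (p : E) + f p • e ∈ frontier C := fun p hp =>
    hc.mem p (hball hp)
  obtain ⟨c, hcint⟩ := hC.2.2
  set x := x₁ + t • v with hx
  have hxb : x ∈ Metric.ball x₀ ρ := hmemball t htI
  have poly : ∀ ε > 0, ∃ (T : Finset E) (g : T → StrongDual ℝ E) (b : T → ℝ) (h : ℝ → ℝ),
      IsLowerProfile g b x₁ v e h (5 * K * ‖v‖) ∧ (∀ i, g i y ≤ b i) ∧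
      h 0 = f x₁ ∧ h 1 = f (x₁ + v) ∧ h t = f x ∧
      (∀ s ∈ Icc (0 : ℝ) 1, |h s - f x₀| ≤ 5 * K * ρ) ∧
      (∀ a ∈ frontier C, ∀ z ∈ frontier C,
        pathELength (frontier C) a z ≤ pathELength (halfspaceUnion g b) a z) ∧
      pathELength (halfspaceUnion g b) (x + f x • e) y ≤
        ENNReal.ofReal (1 + ε) * pathELength (frontier C) (x + f x • e) y +
          ENNReal.ofReal (ε * (‖(x : E) + f x • e - c‖ + ‖y - c‖)) := by
    intro ε hε
    obtain ⟨T, g, b, hg, hS, h1, h2⟩ := hC.exists_polyhedral_approximation hcint hε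
      (S := {(x₁ : E) + f x₁ • e, ((x₁ + v : H) : E) + f (x₁ + v) • e, (x : E) + f x • e, y}) (by
        simp only [Finset.mem_insert, Finset.mem_singleton]
        rintro s (rfl | rfl | rfl | rfl)
        exacts [hfr _ hx₁, hfr _ hx₂, hfr _ hxb, hy])
    obtain ⟨h, hprof, hbd, heq⟩ := hc.exists_profile hC hK hρ hg hv hmemball (hS _ (by simp))
    refine ⟨T, g, b, h, hprof,
      fun i => hC.le_of_interior_le (hg i) y (hC.1.isClosed.frontier_subset hy),
      by simpa using heq 0 (by simp) (by simpa using hS (x₁ + f x₁ • e) (by simp)),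
      by simpa using heq 1 (by simp) (by simpa using hS ((x₁ + v : H) + f (x₁ + v) • e) (by simp)),
      heq t htI (hS _ (by simp [hx])), hbd, h1, h2 _ (by simp) _ (by simp)⟩
  have hG0 : ∀ {h : ℝ → ℝ}, h 0 = f x₁ →
      (x₁ : E) + (0 : ℝ) • (v : E) + h 0 • e = x₁ + f x₁ • e := fun h0 => by
    rw [h0, zero_smul, add_zero]
  have hG1 : ∀ {h : ℝ → ℝ}, h 1 = f (x₁ + v) →
      (x₁ : E) + (1 : ℝ) • (v : E) + h 1 • e = (x₁ + v : H) + f (x₁ + v) • e := fun h1 => by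
    rw [h1, one_smul, Submodule.coe_add]
  have hGt : ∀ {h : ℝ → ℝ}, h t = f x →
      (x₁ : E) + t • (v : E) + h t • e = x + f x • e := fun h1 => by
    rw [h1, hx, Submodule.coe_add, Submodule.coe_smul]
  have hnorm : (1 - t) * ‖x₁‖ ^ 2 + t * ‖x₁ + v‖ ^ 2 - ‖x‖ ^ 2 = (t - t ^ 2) * ‖v‖ ^ 2 := by
    rw [hx, norm_add_sq_real, norm_add_sq_real, norm_smul, inner_smul_right, Real.norm_of_nonneg ht]
    ring
  have h0I : (0 : ℝ) ∈ Icc (0 : ℝ) 1 := by simp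
  have h1I : (1 : ℝ) ∈ Icc (0 : ℝ) 1 := by simp
  simp only [intrinsicDist_eq_toReal, smul_eq_mul]
  by_cases htop : pathELength (frontier C) (x + f x • e) y = ⊤
  · obtain ⟨T, g, b, h, hprof, -, h0, h1, h2, -, hle, -⟩ := poly 1 one_pos
    have key : ∀ s ∈ Icc (0 : ℝ) 1, ∀ p ∈ Metric.ball x₀ ρ,
        (x₁ : E) + s • (v : E) + h s • e = p + f p • e →
        pathELength (frontier C) (p + f p • e) y = ⊤ := by
      intro s hs p hp hGs
      by_contra hne
      have h3 := hprof.pathELength_le hc.norm_eq hs htI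
      rw [hGt h2, hGs] at h3
      refine absurd htop (ne_of_lt ?_)
      refine (pathELength_triangle _ _ (p + f p • e) _).trans_lt
        (ENNReal.add_lt_top.2 ⟨?_, lt_top_iff_ne_top.2 hne⟩)
      exact (hle _ (hfr x hxb) _ (hfr p hp)).trans_lt (h3.trans_lt ENNReal.ofReal_lt_top)
    rw [htop, key 0 h0I x₁ hx₁ (hG0 h0), key 1 h1I (x₁ + v) hx₂ (hG1 h1)]
    obtain ⟨i, hi⟩ := hprof.exists_eq t htI
    obtain ⟨l, -, -, h3⟩ := hprof.exists_slope hc.norm_eq htI hi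
    have h4 := (h3 0 h0I).1
    have h5 := (h3 1 h1I).1
    rw [h0, h2] at h4
    rw [h1, h2] at h5
    have h6 := mul_nonneg ha h4
    have h7 := mul_nonneg ht h5
    have hκ0 : 0 ≤ κ := by
      by_contra! hneg
      nlinarith [sq_nonneg (1 + 5 * K), mul_neg_of_neg_of_pos hneg hδ]
    have h8 : 0 ≤ κ * ((t - t ^ 2) * ‖v‖ ^ 2) :=
      mul_nonneg hκ0 (mul_nonneg (by nlinarith) (sq_nonneg _))
    rw [← hnorm] at h8
    linarith
  · set D := pathELength (frontier C) (x + f x • e) y with hD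
    set R := ‖(x : E) + f x • e - c‖ + ‖y - c‖ with hR
    have hR0 : 0 ≤ R := by positivity
    have hmain : ∀ ε > 0,
        (1 - t) * ((pathELength (frontier C) (x₁ + f x₁ • e) y).toReal -
          (f x₁ + κ * ‖x₁‖ ^ 2)) + t * ((pathELength (frontier C) ((x₁ + v : H) +
          f (x₁ + v) • e) y).toReal - (f (x₁ + v) + κ * ‖x₁ + v‖ ^ 2)) ≤
        D.toReal - (f x + κ * ‖x‖ ^ 2) + ε * (D.toReal + R) := by
      intro ε hε
      obtain ⟨T, g, b, h, hprof, hgy, h0, h1, h2, hbd, hle, happ⟩ := poly ε hε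
      have hfint : pathELength (halfspaceUnion g b) (x + f x • e) y ≠ ⊤ :=
        (happ.trans_lt (ENNReal.add_lt_top.2
          ⟨ENNReal.mul_lt_top ENNReal.ofReal_lt_top (lt_top_iff_ne_top.2 htop),
            ENNReal.ofReal_lt_top⟩)).ne
      have hfin : ∀ s ∈ Icc (0 : ℝ) 1,
          pathELength (halfspaceUnion g b) ((x₁ : E) + s • (v : E) + h s • e) y ≠ ⊤ := fun s hs =>
        hprof.pathELength_ne_top hc.norm_eq htI hs (by rwa [hGt h2])
      have hdist : ∀ s ∈ Icc (0 : ℝ) 1, δ ≤ dist ((x₁ : E) + s • (v : E) + h s • e) y := by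
        intro s hs
        have h3 : dist ((x₀ : E) + f x₀ • e) (x₁ + s • (v : E) + h s • e) ≤ ρ * (1 + 5 * K) := by
          refine (dist_add_add_le _ _ _ _).trans ?_
          rw [dist_eq_norm (f x₀ • e), ← sub_smul, norm_smul, hc.norm_eq, mul_one, Real.norm_eq_abs,
            abs_sub_comm]
          have h4 : dist (x₀ : E) (x₁ + s • (v : E)) < ρ := by
            rw [dist_comm]
            exact Metric.mem_ball.1 (hmemball s hs)
          linarith [hbd s hs]
        have h5 := dist_triangle ((x₀ : E) + f x₀ • e) (x₁ + s • (v : E) + h s • e) y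
        linarith
      have hκv : (‖(v : E)‖ + 5 * K * ‖v‖) ^ 2 < 2 * (κ * ‖v‖ ^ 2) * δ := by
        have hv2 : 0 < ‖v‖ ^ 2 := by positivity
        have h3 := mul_lt_mul_of_pos_left hκ hv2
        have h4 : (‖(v : E)‖ + 5 * K * ‖v‖) ^ 2 = ‖v‖ ^ 2 * (1 + 5 * K) ^ 2 := by
          rw [← Submodule.coe_norm]
          ring
        linarith
      have hchord := hprof.chord_le hc.norm_eq hgy hδ hdist hκv hfin (fun _ => rfl) htI
      beta_reduce at hchord
      rw [hG0 h0, hG1 h1, hGt h2, h0, h1, h2] at hchord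
      have f0 := hfin 0 h0I
      have f1 := hfin 1 h1I
      rw [hG0 h0] at f0
      rw [hG1 h1] at f1
      have e0 := mul_le_mul_of_nonneg_left
        (ENNReal.toReal_mono f0 (hle _ (hfr x₁ hx₁) _ hy)) ha
      have e1 := mul_le_mul_of_nonneg_left
        (ENNReal.toReal_mono f1 (hle _ (hfr _ hx₂) _ hy)) ht
      have e2 : (pathELength (halfspaceUnion g b) (x + f x • e) y).toReal ≤
          (1 + ε) * D.toReal + ε * R := by
        refine ENNReal.toReal_le_of_le_ofReal (by positivity) (happ.trans_eq ?_)
        rw [ENNReal.ofReal_add (p := (1 + ε) * D.toReal) (by positivity) (by positivity),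
          ENNReal.ofReal_mul (p := 1 + ε) (by positivity), ENNReal.ofReal_toReal htop]
      linarith [congrArg (κ * ·) hnorm]
    refine le_of_forall_pos_le_add fun η hη => ?_
    have hM : 0 < D.toReal + R + 1 := by positivity
    refine (hmain (η / (D.toReal + R + 1)) (by positivity)).trans ?_
    gcongr
    rw [div_mul_eq_mul_div, div_le_iff₀ hM]
    exact mul_le_mul_of_nonneg_left (by linarith) hη.le

end ChartConcavity

section DistanceFromSet

variable {E : Type*} [NormedAddCommGroup E] [InnerProductSpace ℝ E] {C : Set E}

theorem IsLowerChart.mono {H : Submodule ℝ E} {e : E} {f : H → ℝ} {K : ℝ} {x₀ : H} {r r' : ℝ}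
    (hc : IsLowerChart C e f K x₀ r) (h : r' ≤ r) : IsLowerChart C e f K x₀ r' :=
  have hsub : Metric.ball x₀ r' ⊆ Metric.ball x₀ r := Metric.ball_subset_ball h
  ⟨hc.norm_eq, fun x hx => hc.mem x (hsub hx), fun x hx => hc.above x (hsub hx),
    fun x hx x' hx' => hc.lip x (hsub hx) x' (hsub hx')⟩

theorem IsLowerChart.convexOn {H : Submodule ℝ E} {e : E} {f : H → ℝ} {K : ℝ} {x₀ : H} {r : ℝ}
    (hc : IsLowerChart C e f K x₀ r) (hC : IsConvexBody C) :
    ConvexOn ℝ (Metric.ball x₀ r) f := by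
  refine ⟨convex_ball _ _, fun x hx y hy a b ha hb hab => ?_⟩
  by_contra! hlt
  set z := a • x + b • y with hz
  have hzb : z ∈ Metric.ball x₀ r := convex_ball x₀ r hx hy ha hb hab
  have hfr : ∀ p ∈ Metric.ball x₀ r, (p : E) + f p • e ∈ C := fun p hp =>
    hC.1.isClosed.frontier_subset (hc.mem p hp)
  have h1 : (z : E) + (a • f x + b • f y) • e ∈ C := by
    have h2 := hC.2.1 (hfr x hx) (hfr y hy) ha hb hab
    convert h2 using 1
    rw [hz, Submodule.coe_add, Submodule.coe_smul, Submodule.coe_smul, smul_eq_mul, smul_eq_mul]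
    module
  obtain ⟨t, ht, hmem⟩ := hc.above z hzb
  refine (hc.mem z hzb).2 (hC.2.1.openSegment_self_interior_subset_interior h1 hmem ?_)
  set s := a • f x + b • f y
  have hpos : 0 < t - s := by linarith
  refine ⟨(t - f z) / (t - s), (f z - s) / (t - s), div_pos (sub_pos.2 ht) hpos,
    div_pos (sub_pos.2 hlt) hpos, by field_simp; ring, ?_⟩
  have e1 : (t - f z) / (t - s) + (f z - s) / (t - s) = 1 := by field_simp; ring
  have e2 : (t - f z) / (t - s) * s + (f z - s) / (t - s) * t = f z := by field_simp; ring
  calc _ = ((t - f z) / (t - s) + (f z - s) / (t - s)) • (z : E) +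
      ((t - f z) / (t - s) * s + (f z - s) / (t - s) * t) • e := by module
    _ = _ := by rw [e1, e2, one_smul]

theorem exists_isLowerChart {H : Submodule ℝ E} {e : E} {f : H → ℝ} {V U : Set H} {K : ℝ≥0}
    (he : ‖e‖ = 1) (hlip : LipschitzOnWith K f V)
    (hmem : ∀ x ∈ V, (x : E) + f x • e ∈ frontier C) (hU : IsOpen U) (hUV : U ⊆ V) {x₀ : H}
    (hx₀ : x₀ ∈ U) {t : ℝ} (ht : f x₀ < t) (htC : (x₀ : E) + t • e ∈ interior C) :
    ∃ r > 0, Metric.ball x₀ r ⊆ U ∧ IsLowerChart C e f K x₀ r := by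
  have hcont : ContinuousAt f x₀ :=
    hlip.continuousOn.continuousAt (mem_of_superset (hU.mem_nhds hx₀) hUV)
  have h1 : ∀ᶠ x in 𝓝 x₀, f x < t := hcont.eventually_lt_const ht
  have h2 : ∀ᶠ x : H in 𝓝 x₀, (x : E) + t • e ∈ interior C :=
    (Continuous.continuousAt (by fun_prop)).eventually_mem (isOpen_interior.mem_nhds htC)
  obtain ⟨r, hr, hball⟩ := Metric.eventually_nhds_iff_ball.1
    ((hU.eventually_mem hx₀).and (h1.and h2))
  refine ⟨r, hr, fun x hx => (hball x hx).1, he, fun x hx => hmem x (hUV (hball x hx).1),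
    fun x hx => ⟨t, (hball x hx).2⟩, fun x hx x' hx' => ?_⟩
  have := hlip.dist_le_mul x (hUV (hball x hx).1) x' (hUV (hball x' hx').1)
  rwa [Real.dist_eq, dist_eq_norm] at this

theorem IsLowerChart.exists_isDCOn [FiniteDimensional ℝ E] {H : Submodule ℝ E} {e : E} {f : H → ℝ}
    {K : ℝ} {x₀ : H} {r : ℝ} (hc : IsLowerChart C e f K x₀ r) (hC : IsConvexBody C) (hr : 0 < r)
    (hK : 0 ≤ K) {F : Set E} (hne : F.Nonempty) (hF : IsClosed F) (hFC : F ⊆ frontier C)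
    (hx₀ : (x₀ : E) + f x₀ • e ∉ F) :
    ∃ ρ > 0, ρ ≤ r ∧ IsDCOn (Metric.ball x₀ ρ)
      fun x => ⨅ y : F, intrinsicDist (frontier C) (x + f x • e) y := by
  have : Nonempty F := hne.to_subtype
  obtain ⟨δ, hδ, hball⟩ := Metric.isOpen_iff.1 hF.isOpen_compl _ hx₀
  have hdist : ∀ y ∈ F, 2 * (δ / 2) ≤ dist ((x₀ : E) + f x₀ • e) y := fun y hy => by
    by_contra! hlt
    exact hball (Metric.mem_ball'.2 (by linarith)) hy
  have hK' : 0 < 1 + 5 * K := by positivity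
  set ρ := min (r / 2) (δ / 2 / (1 + 5 * K)) with hρ
  have hρ0 : 0 < ρ := lt_min (by positivity) (by positivity)
  have hρr : 2 * ρ ≤ r := by linarith [min_le_left (r / 2) (δ / 2 / (1 + 5 * K))]
  have hρδ : ρ * (1 + 5 * K) ≤ δ / 2 := (le_div_iff₀ hK').1 (min_le_right _ _)
  set κ := 2 * (1 + 5 * K) ^ 2 / δ with hκ
  have hκ0 : 0 ≤ κ := by positivity
  have hκδ : (1 + 5 * K) ^ 2 < 2 * κ * (δ / 2) := by
    have : 2 * κ * (δ / 2) = 2 * (1 + 5 * K) ^ 2 := by rw [hκ]; field_simp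
    rw [this]
    linarith [pow_pos hK' 2]
  have hc' := hc.mono hρr
  have hconc := fun y : F => hc'.concaveOn_intrinsicDist hC hK hρ0 (hFC y.2)
    (half_pos hδ) hρδ hκδ (hdist y y.2)
  set φ : H → ℝ := fun x => ⨅ y : F, intrinsicDist (frontier C) (x + f x • e) y with hφ
  have hbdd : ∀ x : H, BddBelow (range fun y : F => intrinsicDist (frontier C) (x + f x • e) y) :=
    fun x => ⟨0, by rintro _ ⟨y, rfl⟩; exact ENNReal.toReal_nonneg⟩
  have hφc : ConcaveOn ℝ (Metric.ball x₀ ρ) fun x => φ x - (f x + κ * ‖x‖ ^ 2) := by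
    refine ⟨convex_ball _ _, fun x hx y hy a b ha hb hab => ?_⟩
    rw [le_sub_iff_add_le]
    refine le_ciInf fun z => ?_
    have h1 := (hconc z).2 hx hy ha hb hab
    have h2 := mul_le_mul_of_nonneg_left (ciInf_le (hbdd x) z) ha
    have h3 := mul_le_mul_of_nonneg_left (ciInf_le (hbdd y) z) hb
    simp only [smul_eq_mul] at h1 ⊢
    linarith
  have hsub : Metric.ball x₀ ρ ⊆ Metric.ball x₀ (2 * ρ) := Metric.ball_subset_ball (by linarith)
  have hfc : ConvexOn ℝ (Metric.ball x₀ ρ) fun x => f x + κ * ‖x‖ ^ 2 :=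
    ((hc'.convexOn hC).subset hsub (convex_ball _ _)).add
      (((convexOn_norm (convex_ball _ _)).pow (fun x _ => norm_nonneg x) 2).smul hκ0)
  refine ⟨ρ, hρ0, by linarith, _, _, hfc, hφc.neg, hfc.continuousOn Metric.isOpen_ball,
    hφc.neg.continuousOn Metric.isOpen_ball, fun x _ => ?_⟩
  simp only [Pi.neg_apply]
  ring

/-- The line through a chart point in the direction of the chart meets the interior of the
body. -/
theorem IsConvexBody.exists_add_smul_mem_interior (hC : IsConvexBody C) {e : E}
    {V : Set ↥((Submodule.span ℝ {e})ᗮ)} (hV : IsOpen V) {f : ↥((Submodule.span ℝ {e})ᗮ) → ℝ}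
    (hmem : ∀ x ∈ V, (x : E) + f x • e ∈ frontier C) {x₀ : ↥((Submodule.span ℝ {e})ᗮ)}
    (hx₀ : x₀ ∈ V) : ∃ t : ℝ, (x₀ : E) + t • e ∈ interior C := by
  obtain ⟨c, hc⟩ := hC.2.2
  obtain ⟨p, hp, w, hw, hcp⟩ := (Submodule.span ℝ {e}).exists_add_mem_mem_orthogonal (c - x₀)
  obtain ⟨a, rfl⟩ := Submodule.mem_span_singleton.1 hp
  have hlim : Continuous fun s : ℝ => x₀ - s • (⟨w, hw⟩ : ↥((Submodule.span ℝ {e})ᗮ)) := by fun_prop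
  have hev : ∀ᶠ s in 𝓝[>] (0 : ℝ), x₀ - s • (⟨w, hw⟩ : ↥((Submodule.span ℝ {e})ᗮ)) ∈ V :=
    (hlim.continuousAt.eventually_mem (by simpa using hV.mem_nhds hx₀)).filter_mono
      nhdsWithin_le_nhds
  obtain ⟨s, hs, hs0⟩ := (hev.and self_mem_nhdsWithin).exists
  have hs0 : 0 < s := hs0
  set x := x₀ - s • (⟨w, hw⟩ : ↥((Submodule.span ℝ {e})ᗮ)) with hx
  have hxC := hC.1.isClosed.frontier_subset (hmem x hs)
  refine ⟨(f x + s * a) / (1 + s), hC.2.1.openSegment_self_interior_subset_interior hxC hc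
    ⟨1 / (1 + s), s / (1 + s), by positivity, by positivity, by field_simp, ?_⟩⟩
  have hcw : c = x₀ + (a • e + w) := by rw [← hcp]; abel
  have hxw : (x : E) = x₀ - s • w := rfl
  rw [hcw, hxw]
  have h1 : 1 / (1 + s) + s / (1 + s) = 1 := by field_simp
  calc _ = (1 / (1 + s) + s / (1 + s)) • (x₀ : E) + ((f x + s * a) / (1 + s)) • e := by module
    _ = _ := by rw [h1, one_smul]

end DistanceFromSet

/-- Let `X ⊂ ℝ^{n+1}` be a convex surface, `∅ ≠ F ⊆ X` closed, and
`d_F(z) = inf_{y ∈ F} dist_X(z,y)`. Then for every standard chart `(e,V)` on `X` with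
associated convex function `f`, the function `x ↦ d_F(x + f(x)e)` is locally DC on the
open set `{x ∈ V : x + f(x)e ∉ F}`. -/
theorem dist_from_set_locallyDC (n : ℕ)
    (X : Set (EuclideanSpace ℝ (Fin (n + 1)))) (hX : IsConvexSurface X)
    (F : Set (EuclideanSpace ℝ (Fin (n + 1)))) (hFne : F.Nonempty) (hFcl : IsClosed F)
    (hFX : F ⊆ X)
    (e : EuclideanSpace ℝ (Fin (n + 1)))
    (V : Set ↥((Submodule.span ℝ {e})ᗮ)) (f : ↥((Submodule.span ℝ {e})ᗮ) → ℝ)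
    (hchart : IsStandardChart X e V f) :
    LocallyDCOn
      {x : ↥((Submodule.span ℝ {e})ᗮ) | x ∈ V ∧
        (x : EuclideanSpace ℝ (Fin (n + 1))) + f x • e ∉ F}
      (fun x : ↥((Submodule.span ℝ {e})ᗮ) =>
        ⨅ y : F, intrinsicDist X ((x : EuclideanSpace ℝ (Fin (n + 1))) + f x • e)
          (y : EuclideanSpace ℝ (Fin (n + 1)))) := by
  obtain ⟨C, hC, rfl⟩ := hX
  obtain ⟨he, hV, -, -, ⟨K, hlip⟩, O, -, hO⟩ := hchart
  have hmem : ∀ x ∈ V, (x : EuclideanSpace ℝ (Fin (n + 1))) + f x • e ∈ frontier C :=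
    fun x hx => (hO.subset (mem_image_of_mem _ hx)).1
  have hcont : ContinuousOn
      (fun x : ↥((Submodule.span ℝ {e})ᗮ) => (x : EuclideanSpace ℝ (Fin (n + 1))) + f x • e) V :=
    continuous_subtype_val.continuousOn.add (hlip.continuousOn.smul continuousOn_const)
  have hU := hcont.isOpen_inter_preimage hV hFcl.isOpen_compl
  rintro x₀ ⟨hxV, hxF⟩
  obtain ⟨t, ht⟩ := hC.exists_add_smul_mem_interior hV hmem hxV
  obtain h | rfl | h := lt_trichotomy (f x₀) t
  · obtain ⟨r, hr, hrU, hc⟩ := exists_isLowerChart he hlip hmem hU inter_subset_left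
      ⟨hxV, hxF⟩ h ht
    obtain ⟨ρ, hρ, hρr, hdc⟩ := hc.exists_isDCOn hC hr K.2 hFne hFcl hFX hxF
    exact ⟨Metric.ball x₀ ρ, Metric.isOpen_ball, convex_ball _ _, Metric.mem_ball_self hρ,
      (Metric.ball_subset_ball hρr).trans hrU, hdc⟩
  · exact absurd ht (hmem x₀ hxV).2
  · obtain ⟨r, hr, hrU, hc⟩ := exists_isLowerChart (C := C) (e := -e) (f := fun x => -f x)
      (t := -t) (by rwa [norm_neg]) hlip.neg (by simpa only [neg_smul_neg] using hmem) hU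
      inter_subset_left ⟨hxV, hxF⟩ (neg_lt_neg h) (by rwa [neg_smul_neg])
    obtain ⟨ρ, hρ, hρr, hdc⟩ := hc.exists_isDCOn hC hr K.2 hFne hFcl hFX (by rwa [neg_smul_neg])
    simp only [neg_smul_neg] at hdc
    exact ⟨Metric.ball x₀ ρ, Metric.isOpen_ball, convex_ball _ _, Metric.mem_ball_self hρ,
      (Metric.ball_subset_ball hρr).trans hrU, hdc⟩
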